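/- arXiv:1703.10942 — 4 statements merged into one kernel-verified Lean document; each statement's English description precedes it below -/
import Mathlib

section
/- Let k be a field of characteristic p > 0 and let G be a cyclic group of order p. Let A be a kG-module (not necessarily finite-dimensional) equipped with a stable tt-ring structure (μ, u, σ). Then there exist finitely many finite separable field extensions L₁, …, L_n of k and a kG-linear map φ: A → L₁ × ⋯ × L_n, where the product algebra L₁ × ⋯ × L_n is given the trivial G-action and its componentwise ring structure (μ', u'), such that φ is a stable isomorphism and φ∘μ − μ'∘(φ⊗φ) and φ∘u − u' are stably trivial. -/
open TensorProduct

section Defs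

variable {k G : Type} [Field k] [Group G]

/-- A `kG`-linear map between two representations of `G` over `k`:
a `k`-linear map commuting with the `G`-actions. -/
def Equivariant {V W : Type} [AddCommGroup V] [Module k V] [AddCommGroup W] [Module k W]
    (ρV : Representation k G V) (ρW : Representation k G W) (f : V →ₗ[k] W) : Prop :=
  ∀ g : G, f ∘ₗ ρV g = ρW g ∘ₗ f

/-- A `kG`-linear map is stably trivial if it factors through a projective
`kG`-module (equivariantly). -/
def StablyTrivial {V W : Type} [AddCommGroup V] [Module k V] [AddCommGroup W] [Module k W]
    (ρV : Representation k G V) (ρW : Representation k G W) (f : V →ₗ[k] W) : Prop :=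
  ∃ (P : Type) (_ : AddCommGroup P) (_ : Module k P) (ρP : Representation k G P),
    Module.Projective (MonoidAlgebra k G) ρP.asModule ∧
    ∃ (a : V →ₗ[k] P) (b : P →ₗ[k] W),
      Equivariant ρV ρP a ∧ Equivariant ρP ρW b ∧ f = b ∘ₗ a

/-- A `kG`-linear map is a stable isomorphism if it is invertible up to
stably trivial maps. -/
def StableIso {V W : Type} [AddCommGroup V] [Module k V] [AddCommGroup W] [Module k W]
    (ρV : Representation k G V) (ρW : Representation k G W) (f : V →ₗ[k] W) : Prop :=
  Equivariant ρV ρW f ∧ ∃ ψ : W →ₗ[k] V, Equivariant ρW ρV ψ ∧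
    StablyTrivial ρV ρV (ψ ∘ₗ f - LinearMap.id) ∧
    StablyTrivial ρW ρW (f ∘ₗ ψ - LinearMap.id)

/-- A stable tt-ring structure on a `kG`-module `A`: a commutative, separable,
associative and unital multiplication, where all identities hold up to stably
trivial maps (i.e. in the stable module category). -/
structure StableTTRing {A : Type} [AddCommGroup A] [Module k A]
    (ρ : Representation k G A) where
  mul : A ⊗[k] A →ₗ[k] A
  one : k →ₗ[k] A
  sec : A →ₗ[k] A ⊗[k] A
  mul_equivariant : Equivariant (ρ.tprod ρ) ρ mul
  one_equivariant : Equivariant (Representation.trivial k (G := G) (V := k)) ρ one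
  sec_equivariant : Equivariant ρ (ρ.tprod ρ) sec
  assoc : StablyTrivial ((ρ.tprod ρ).tprod ρ) ρ
    (mul ∘ₗ mul.rTensor A -
      mul ∘ₗ mul.lTensor A ∘ₗ (TensorProduct.assoc k A A A).toLinearMap)
  one_mul : StablyTrivial ρ ρ
    (mul ∘ₗ one.rTensor A ∘ₗ (TensorProduct.lid k A).symm.toLinearMap - LinearMap.id)
  mul_one : StablyTrivial ρ ρ
    (mul ∘ₗ one.lTensor A ∘ₗ (TensorProduct.rid k A).symm.toLinearMap - LinearMap.id)
  mul_comm : StablyTrivial (ρ.tprod ρ) ρ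
    (mul ∘ₗ (TensorProduct.comm k A A).toLinearMap - mul)
  sep : StablyTrivial ρ ρ (mul ∘ₗ sec - LinearMap.id)
  sec_left : StablyTrivial (ρ.tprod ρ) (ρ.tprod ρ)
    (mul.rTensor A ∘ₗ (TensorProduct.assoc k A A A).symm.toLinearMap ∘ₗ sec.lTensor A
      - sec ∘ₗ mul)
  sec_right : StablyTrivial (ρ.tprod ρ) (ρ.tprod ρ)
    (mul.lTensor A ∘ₗ (TensorProduct.assoc k A A A).toLinearMap ∘ₗ sec.rTensor A
      - sec ∘ₗ mul)

end Defs

section Basic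

variable {k G : Type} [Field k] [Group G]
variable {U V W X Y : Type} [AddCommGroup U] [Module k U] [AddCommGroup V] [Module k V]
  [AddCommGroup W] [Module k W] [AddCommGroup X] [Module k X] [AddCommGroup Y] [Module k Y]
variable {ρU : Representation k G U} {ρV : Representation k G V} {ρW : Representation k G W}
  {ρX : Representation k G X} {ρY : Representation k G Y}

theorem Equivariant.apply {f : V →ₗ[k] W} (hf : Equivariant ρV ρW f) (g : G) (v : V) :
    f (ρV g v) = ρW g (f v) :=
  LinearMap.congr_fun (hf g) v

theorem Equivariant.of_apply {f : V →ₗ[k] W} (hf : ∀ g v, f (ρV g v) = ρW g (f v)) :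
    Equivariant ρV ρW f :=
  fun g => LinearMap.ext (hf g)

theorem Equivariant.id : Equivariant ρV ρV LinearMap.id := fun _ => rfl

theorem Equivariant.comp {f : V →ₗ[k] W} {f' : W →ₗ[k] X} (hf' : Equivariant ρW ρX f')
    (hf : Equivariant ρV ρW f) : Equivariant ρV ρX (f' ∘ₗ f) :=
  .of_apply fun g v => by simp [hf.apply, hf'.apply]

theorem Equivariant.map {f : V →ₗ[k] W} {f' : X →ₗ[k] Y} (hf : Equivariant ρV ρW f)
    (hf' : Equivariant ρX ρY f') :
    Equivariant (ρV.tprod ρX) (ρW.tprod ρY) (TensorProduct.map f f') := fun g => by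
  simp only [Representation.tprod_apply, ← TensorProduct.map_comp, hf g, hf' g]

theorem Equivariant.lTensor {f : V →ₗ[k] W} (hf : Equivariant ρV ρW f) :
    Equivariant (ρX.tprod ρV) (ρX.tprod ρW) (f.lTensor X) :=
  Equivariant.id.map hf

theorem Equivariant.rTensor {f : V →ₗ[k] W} (hf : Equivariant ρV ρW f) :
    Equivariant (ρV.tprod ρX) (ρW.tprod ρX) (f.rTensor X) :=
  hf.map Equivariant.id

theorem equivariant_assoc : Equivariant ((ρU.tprod ρV).tprod ρW) (ρU.tprod (ρV.tprod ρW))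
    (TensorProduct.assoc k U V W).toLinearMap := fun g => by
  ext u v w; simp

theorem equivariant_assoc_symm : Equivariant (ρU.tprod (ρV.tprod ρW)) ((ρU.tprod ρV).tprod ρW)
    (TensorProduct.assoc k U V W).symm.toLinearMap := fun g => by
  ext u v w; simp

theorem equivariant_comm : Equivariant (ρU.tprod ρV) (ρV.tprod ρU)
    (TensorProduct.comm k U V).toLinearMap := fun g => by
  ext u v; simp

theorem equivariant_tensorTensorTensorComm :
    Equivariant ((ρU.tprod ρV).tprod (ρW.tprod ρX)) ((ρU.tprod ρW).tprod (ρV.tprod ρX))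
    (TensorProduct.tensorTensorTensorComm k U V W X).toLinearMap := fun g => by
  ext u v; simp

theorem equivariant_mk {u : U} (hu : u ∈ ρU.invariants) :
    Equivariant ρV (ρU.tprod ρV) (TensorProduct.mk k U V u) :=
  .of_apply fun g v => by simp [(Representation.mem_invariants ρU u).1 hu g]

theorem equivariant_mk_flip {u : U} (hu : u ∈ ρU.invariants) :
    Equivariant ρV (ρV.tprod ρU) ((TensorProduct.mk k V U).flip u) :=
  .of_apply fun g v => by simp [(Representation.mem_invariants ρU u).1 hu g]

theorem Equivariant.mem_invariants {f : V →ₗ[k] W} (hf : Equivariant ρV ρW f) {v : V}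
    (hv : v ∈ ρV.invariants) : f v ∈ ρW.invariants := fun g => by
  rw [← hf.apply, hv g]

theorem tmul_mem_invariants {v : V} {w : W} (hv : v ∈ ρV.invariants) (hw : w ∈ ρW.invariants) :
    v ⊗ₜ[k] w ∈ (ρV.tprod ρW).invariants := fun g => by
  simp [hv g, hw g]

variable [Fintype G]

theorem Representation.norm_mem_invariants (ρ : Representation k G V) (v : V) :
    ρ.norm v ∈ ρ.invariants :=
  fun g => by simp

theorem Equivariant.apply_norm {f : V →ₗ[k] W} (hf : Equivariant ρV ρW f) (v : V) :
    f (ρV.norm v) = ρW.norm (f v) := by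
  simp [Representation.norm, hf.apply]

theorem norm_tprod_tmul_left {v : V} (hv : v ∈ ρV.invariants) (w : W) :
    (ρV.tprod ρW).norm (v ⊗ₜ w) = v ⊗ₜ ρW.norm w := by
  simp [Representation.norm, hv _, TensorProduct.tmul_sum]

theorem norm_tprod_tmul_right (v : V) {w : W} (hw : w ∈ ρW.invariants) :
    (ρV.tprod ρW).norm (v ⊗ₜ w) = ρV.norm v ⊗ₜ w := by
  simp [Representation.norm, hw _, TensorProduct.sum_tmul]

/-- A linear map between representations is a trace if it is the sum of the conjugates of some
linear map. -/
def IsTrace (ρV : Representation k G V) (ρW : Representation k G W) (f : V →ₗ[k] W) : Prop :=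
  ∃ h : V →ₗ[k] W, f = ∑ g : G, ρW g ∘ₗ h ∘ₗ ρV g⁻¹

theorem isTrace_iff {f : V →ₗ[k] W} :
    IsTrace ρV ρW f ↔ ∃ h : V →ₗ[k] W, ∀ v, f v = ∑ g : G, ρW g (h (ρV g⁻¹ v)) := by
  refine exists_congr fun h => ⟨fun hf v => by simp [hf], fun hf => LinearMap.ext fun v => ?_⟩
  simp [hf]

namespace IsTrace

theorem zero : IsTrace ρV ρW 0 := ⟨0, by simp⟩

theorem add {f f' : V →ₗ[k] W} (hf : IsTrace ρV ρW f) (hf' : IsTrace ρV ρW f') :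
    IsTrace ρV ρW (f + f') := by
  obtain ⟨h, rfl⟩ := hf
  obtain ⟨h', rfl⟩ := hf'
  exact ⟨h + h', by simp [LinearMap.comp_add, LinearMap.add_comp, Finset.sum_add_distrib]⟩

theorem smul (c : k) {f : V →ₗ[k] W} (hf : IsTrace ρV ρW f) : IsTrace ρV ρW (c • f) := by
  obtain ⟨h, rfl⟩ := hf
  exact ⟨c • h, by simp [LinearMap.comp_smul, LinearMap.smul_comp, Finset.smul_sum]⟩

theorem neg {f : V →ₗ[k] W} (hf : IsTrace ρV ρW f) : IsTrace ρV ρW (-f) := by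
  simpa using hf.smul (-1)

theorem comp_left {f : V →ₗ[k] W} (hf : IsTrace ρV ρW f) {f' : W →ₗ[k] X}
    (hf' : Equivariant ρW ρX f') : IsTrace ρV ρX (f' ∘ₗ f) := by
  rw [isTrace_iff] at hf ⊢
  obtain ⟨h, hf⟩ := hf
  exact ⟨f' ∘ₗ h, fun v => by simp [hf, hf'.apply]⟩

theorem comp_right {f : W →ₗ[k] X} (hf : IsTrace ρW ρX f) {f' : V →ₗ[k] W}
    (hf' : Equivariant ρV ρW f') : IsTrace ρV ρX (f ∘ₗ f') := by
  rw [isTrace_iff] at hf ⊢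
  obtain ⟨h, hf⟩ := hf
  exact ⟨h ∘ₗ f', fun v => by simp [hf, hf'.apply]⟩

theorem map_left {f : V →ₗ[k] W} (hf : IsTrace ρV ρW f) {f' : X →ₗ[k] Y}
    (hf' : Equivariant ρX ρY f') :
    IsTrace (ρV.tprod ρX) (ρW.tprod ρY) (TensorProduct.map f f') := by
  obtain ⟨h, rfl⟩ := hf
  refine ⟨TensorProduct.map h f', ?_⟩
  ext v x
  simp [TensorProduct.sum_tmul, hf'.apply]

theorem map_right {f : V →ₗ[k] W} (hf : IsTrace ρV ρW f) {f' : X →ₗ[k] Y}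
    (hf' : Equivariant ρX ρY f') :
    IsTrace (ρX.tprod ρV) (ρY.tprod ρW) (TensorProduct.map f' f) := by
  obtain ⟨h, rfl⟩ := hf
  refine ⟨TensorProduct.map f' h, ?_⟩
  ext v x
  simp [TensorProduct.tmul_sum, hf'.apply]

theorem exists_norm {f : V →ₗ[k] W} (hf : IsTrace ρV ρW f) {v : V} (hv : v ∈ ρV.invariants) :
    ∃ w, f v = ρW.norm w := by
  obtain ⟨h, hf⟩ := isTrace_iff.1 hf
  exact ⟨h v, by simp [hf, hv _, Representation.norm]⟩

theorem mk_flip_norm (u : U) :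
    IsTrace ρV (ρV.tprod ρU) ((TensorProduct.mk k V U).flip (ρU.norm u)) := by
  refine isTrace_iff.2 ⟨(TensorProduct.mk k V U).flip u, fun v => ?_⟩
  simp [Representation.norm]

theorem mk_norm (u : U) :
    IsTrace ρV (ρU.tprod ρV) (TensorProduct.mk k U V (ρU.norm u)) := by
  refine isTrace_iff.2 ⟨TensorProduct.mk k U V u, fun v => ?_⟩
  simp [Representation.norm]

theorem of_forall_mem_range_norm {f : V →ₗ[k] W} (hf : ∀ g v, f (ρV g v) = f v)
    (hn : ∀ v, f v ∈ LinearMap.range ρW.norm) : IsTrace ρV ρW f := by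
  obtain ⟨s, hs⟩ := ρW.norm.rangeRestrict.exists_rightInverse_of_surjective
    (LinearMap.range_rangeRestrict _)
  refine isTrace_iff.2 ⟨s ∘ₗ f.codRestrict _ hn, fun v => ?_⟩
  have h1 (g : G) : f.codRestrict _ hn (ρV g⁻¹ v) = f.codRestrict _ hn v :=
    Subtype.ext (hf _ _)
  have h2 := congr_arg Subtype.val (LinearMap.congr_fun hs (f.codRestrict _ hn v))
  simp only [LinearMap.comp_apply, h1]
  rw [← LinearMap.sum_apply]
  exact h2.symm

theorem of_norm (ρ : Representation k G V) : IsTrace ρ ρ ρ.norm :=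
  of_forall_mem_range_norm (by simp) fun v => ⟨v, rfl⟩

end IsTrace

/-- Equality of maps in the stable module category. -/
def StableEq (ρV : Representation k G V) (ρW : Representation k G W) (f f' : V →ₗ[k] W) : Prop :=
  IsTrace ρV ρW (f - f')

namespace StableEq

theorem refl (f : V →ₗ[k] W) : StableEq ρV ρW f f := by
  simpa [StableEq] using IsTrace.zero

theorem of_eq {f f' : V →ₗ[k] W} (h : f = f') : StableEq ρV ρW f f' := h ▸ refl f

theorem symm {f f' : V →ₗ[k] W} (h : StableEq ρV ρW f f') : StableEq ρV ρW f' f := by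
  simpa [StableEq] using h.neg

theorem trans {f f' f'' : V →ₗ[k] W} (h : StableEq ρV ρW f f') (h' : StableEq ρV ρW f' f'') :
    StableEq ρV ρW f f'' := by
  simpa [StableEq] using h.add h'

theorem add {f f' e e' : V →ₗ[k] W} (h : StableEq ρV ρW f f') (h' : StableEq ρV ρW e e') :
    StableEq ρV ρW (f + e) (f' + e') := by
  simpa [StableEq, add_sub_add_comm] using IsTrace.add h h'

theorem comp_left {f f' : V →ₗ[k] W} (h : StableEq ρV ρW f f') {e : W →ₗ[k] X}
    (he : Equivariant ρW ρX e) : StableEq ρV ρX (e ∘ₗ f) (e ∘ₗ f') := by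
  simpa [StableEq, LinearMap.comp_sub] using IsTrace.comp_left h he

theorem comp_right {f f' : W →ₗ[k] X} (h : StableEq ρW ρX f f') {e : V →ₗ[k] W}
    (he : Equivariant ρV ρW e) : StableEq ρV ρX (f ∘ₗ e) (f' ∘ₗ e) := by
  simpa [StableEq, LinearMap.sub_comp] using IsTrace.comp_right h he

theorem map {f f' : V →ₗ[k] W} {e e' : X →ₗ[k] Y} (h : StableEq ρV ρW f f')
    (h' : StableEq ρX ρY e e') (hf : Equivariant ρV ρW f') (he : Equivariant ρX ρY e) :
    StableEq (ρV.tprod ρX) (ρW.tprod ρY) (TensorProduct.map f e) (TensorProduct.map f' e') := by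
  have h1 := (IsTrace.map_left h he).add (IsTrace.map_right h' hf)
  unfold StableEq
  convert h1 using 1
  ext v x
  simp [TensorProduct.sub_tmul, TensorProduct.tmul_sub]

theorem lTensor {f f' : V →ₗ[k] W} (h : StableEq ρV ρW f f') :
    StableEq (ρX.tprod ρV) (ρX.tprod ρW) (f.lTensor X) (f'.lTensor X) := by
  rw [StableEq, ← LinearMap.lTensor_sub]
  exact IsTrace.map_right h Equivariant.id

theorem rTensor {f f' : V →ₗ[k] W} (h : StableEq ρV ρW f f') :
    StableEq (ρV.tprod ρX) (ρW.tprod ρX) (f.rTensor X) (f'.rTensor X) := by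
  rw [StableEq, ← LinearMap.rTensor_sub]
  exact IsTrace.map_left h Equivariant.id

theorem exists_norm {f f' : V →ₗ[k] W} (h : StableEq ρV ρW f f') {v : V}
    (hv : v ∈ ρV.invariants) : ∃ w, f v = f' v + ρW.norm w := by
  obtain ⟨w, hw⟩ := IsTrace.exists_norm h hv
  exact ⟨w, by rw [← hw]; simp⟩

end StableEq

end Basic

section Projective

variable {k G : Type} [Field k] [Group G]
variable {V W : Type} [AddCommGroup V] [Module k V] [AddCommGroup W] [Module k W]
  {ρV : Representation k G V} {ρW : Representation k G W}

/-- The representation on functions `G → V` given by `(g • q) x = g • q (g⁻¹ * x)`. -/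
def functionRep (ρ : Representation k G V) : Representation k G (G → V) where
  toFun g := LinearMap.pi fun x => ρ g ∘ₗ LinearMap.proj (g⁻¹ * x)
  map_one' := by ext; simp
  map_mul' g h := by ext; simp [mul_assoc]

theorem functionRep_apply (ρ : Representation k G V) (g : G) (q : G → V) (x : G) :
    functionRep ρ g q x = ρ g (q (g⁻¹ * x)) := rfl

theorem Equivariant.smul_apply {f : V →ₗ[k] W} (hf : Equivariant ρV ρW f) (r : MonoidAlgebra k G)
    (v : ρV.asModule) :
    ρW.asModuleEquiv.symm (f (ρV.asModuleEquiv (r • v))) =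
      r • ρW.asModuleEquiv.symm (f (ρV.asModuleEquiv v)) := by
  induction r using MonoidAlgebra.induction_on with
  | of g =>
    rw [Representation.asModuleEquiv_map_smul, Representation.asAlgebraHom_of, hf.apply,
      Representation.asModuleEquiv_symm_map_rho]
  | add r s hr hs => rw [add_smul, map_add, map_add, map_add, hr, hs, add_smul]
  | smul c r hr => rw [smul_assoc, map_smul, map_smul, map_smul, hr, smul_assoc]

/-- The `k[G]`-linear map underlying an equivariant map. -/
def Equivariant.toAsModule {f : V →ₗ[k] W} (hf : Equivariant ρV ρW f) :
    ρV.asModule →ₗ[MonoidAlgebra k G] ρW.asModule where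
  toFun v := ρW.asModuleEquiv.symm (f (ρV.asModuleEquiv v))
  map_add' := by simp
  map_smul' r v := hf.smul_apply r v

theorem equivariant_of_asModule (f : ρV.asModule →ₗ[MonoidAlgebra k G] ρW.asModule) :
    Equivariant ρV ρW (ρW.asModuleEquiv.toLinearMap ∘ₗ f.restrictScalars k ∘ₗ
      ρV.asModuleEquiv.symm.toLinearMap) :=
  .of_apply fun g v => by
    simp only [LinearMap.comp_apply, LinearEquiv.coe_coe, LinearMap.restrictScalars_apply,
      Representation.asModuleEquiv_symm_map_rho, map_smul, Representation.asModuleEquiv_map_smul,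
      Representation.asAlgebraHom_of]

variable [Fintype G]

/-- Summation of the values of a function. -/
def functionRepSum (G V : Type) [AddCommGroup V] [Module k V] [Fintype G] : (G → V) →ₗ[k] V :=
  ∑ x : G, LinearMap.proj x

theorem equivariant_functionRepSum : Equivariant (functionRep ρV) ρV (functionRepSum G V) :=
  .of_apply fun g q => by
    simp only [functionRepSum, LinearMap.sum_apply, LinearMap.proj_apply, functionRep_apply,
      map_sum]
    exact Equiv.sum_comp (Equiv.mulLeft g⁻¹) fun x => ρV g (q x)

theorem isTrace_id_functionRep (ρ : Representation k G V) :
    IsTrace (functionRep ρ) (functionRep ρ) LinearMap.id := by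
  classical
  refine isTrace_iff.2 ⟨LinearMap.single k (fun _ => V) 1 ∘ₗ LinearMap.proj 1, fun q => ?_⟩
  ext x
  simp only [Finset.sum_apply, functionRep_apply, LinearMap.comp_apply, LinearMap.id_apply,
    LinearMap.proj_apply, LinearMap.single_apply, Pi.single_apply]
  rw [Finset.sum_eq_single x] <;> simp +contextual [inv_mul_eq_one]

theorem isTrace_id_of_projective (ρ : Representation k G V)
    [Module.Projective (MonoidAlgebra k G) ρ.asModule] : IsTrace ρ ρ LinearMap.id := by
  classical
  have hsurj : Function.Surjective (equivariant_functionRepSum (ρV := ρ)).toAsModule := fun v =>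
    ⟨(functionRep ρ).asModuleEquiv.symm (Pi.single 1 (ρ.asModuleEquiv v)), by
      apply ρ.asModuleEquiv.injective
      simp [Equivariant.toAsModule, functionRepSum]⟩
  obtain ⟨s, hs⟩ := Module.projective_lifting_property _ LinearMap.id hsurj
  have h := ((isTrace_id_functionRep ρ).comp_left equivariant_functionRepSum).comp_right
    (equivariant_of_asModule s)
  convert h using 1
  ext v
  exact (LinearMap.congr_fun hs (ρ.asModuleEquiv.symm v)).symm

theorem projective_of_isTrace_id {ρ : Representation k G V} (h : IsTrace ρ ρ LinearMap.id) :
    Module.Projective (MonoidAlgebra k G) ρ.asModule := by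
  obtain ⟨h, hh⟩ := isTrace_iff.1 h
  refine .of_lifting_property'' fun f hf => ?_
  obtain ⟨s, hs⟩ := (f.restrictScalars k).exists_rightInverse_of_surjective
    (LinearMap.range_eq_top.2 hf)
  refine ⟨(s ∘ₗ ρ.asModuleEquiv.symm.toLinearMap ∘ₗ h ∘ₗ
    ρ.asModuleEquiv.toLinearMap).sumOfConjugatesEquivariant G, LinearMap.ext fun v => ?_⟩
  have hs' (w : ρ.asModule) : f (s w) = w := LinearMap.congr_fun hs w
  apply ρ.asModuleEquiv.injective
  rw [LinearMap.comp_apply, LinearMap.sumOfConjugatesEquivariant_apply]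
  simp only [LinearMap.conjugate_apply, LinearMap.comp_apply, map_sum, map_smul, hs']
  rw [LinearMap.id_apply, ← LinearMap.id_apply (R := k) (ρ.asModuleEquiv v), hh]
  refine (Equiv.sum_comp (Equiv.inv G) _).symm.trans ?_
  simp [-Representation.single_smul]

/-- Stably trivial maps are exactly the equivariant traces. -/
theorem stablyTrivial_iff_isTrace {f : V →ₗ[k] W} :
    StablyTrivial ρV ρW f ↔ IsTrace ρV ρW f := by
  constructor
  · rintro ⟨P, _, _, ρP, _, a, b, ha, hb, rfl⟩
    exact ((isTrace_id_of_projective ρP).comp_left hb).comp_right ha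
  · intro hf
    obtain ⟨h, hh⟩ := isTrace_iff.1 hf
    refine ⟨G → W, inferInstance, inferInstance, functionRep ρW,
      projective_of_isTrace_id (isTrace_id_functionRep ρW),
      LinearMap.pi fun x => ρW x ∘ₗ h ∘ₗ ρV x⁻¹, functionRepSum G W, .of_apply fun g v => ?_,
      equivariant_functionRepSum, ?_⟩
    · ext x
      simp [functionRep_apply, ← Module.End.mul_apply, ← map_mul]
    · ext v
      simp [functionRepSum, hh]

end Projective

section StableRing

variable {k G : Type} [Field k] [Group G] [Fintype G]
variable {V W : Type} [AddCommGroup V] [Module k V] [AddCommGroup W] [Module k W]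
  {ρ : Representation k G V} {ρ' : Representation k G W}

/-- The Tate cohomology of degree zero: invariants modulo norms. -/
abbrev TateZero (ρ : Representation k G V) : Type :=
  ρ.invariants ⧸ (LinearMap.range ρ.norm).comap ρ.invariants.subtype

/-- A commutative, associative and unital multiplication, up to traces. -/
structure IsStableCommRing (ρ : Representation k G V) (m : V ⊗[k] V →ₗ[k] V) (o : V) : Prop where
  equivariant : Equivariant (ρ.tprod ρ) ρ m
  one_mem : o ∈ ρ.invariants
  assoc : StableEq ((ρ.tprod ρ).tprod ρ) ρ (m ∘ₗ m.rTensor V)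
    (m ∘ₗ m.lTensor V ∘ₗ (TensorProduct.assoc k V V V).toLinearMap)
  comm : StableEq (ρ.tprod ρ) ρ (m ∘ₗ (TensorProduct.comm k V V).toLinearMap) m
  one_mul : StableEq ρ ρ (m ∘ₗ TensorProduct.mk k V V o) LinearMap.id

/-- The componentwise multiplication on a tensor product. -/
noncomputable def tensorMul (m : V ⊗[k] V →ₗ[k] V) (m' : W ⊗[k] W →ₗ[k] W) :
    (V ⊗[k] W) ⊗[k] (V ⊗[k] W) →ₗ[k] V ⊗[k] W :=
  TensorProduct.map m m' ∘ₗ (TensorProduct.tensorTensorTensorComm k V W V W).toLinearMap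

@[simp]
theorem tensorMul_tmul (m : V ⊗[k] V →ₗ[k] V) (m' : W ⊗[k] W →ₗ[k] W) (v v' : V) (w w' : W) :
    tensorMul m m' ((v ⊗ₜ w) ⊗ₜ (v' ⊗ₜ w')) = m (v ⊗ₜ v') ⊗ₜ m' (w ⊗ₜ w') := rfl

namespace IsStableCommRing

variable {m : V ⊗[k] V →ₗ[k] V} {o : V} {m' : W ⊗[k] W →ₗ[k] W} {o' : W}

theorem tensor (S : IsStableCommRing ρ m o) (S' : IsStableCommRing ρ' m' o') :
    IsStableCommRing (ρ.tprod ρ') (tensorMul m m') (o ⊗ₜ o') where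
  equivariant := (S.equivariant.map S'.equivariant).comp equivariant_tensorTensorTensorComm
  one_mem := tmul_mem_invariants S.one_mem S'.one_mem
  assoc := by
    have h := (S.assoc.map S'.assoc (S.equivariant.comp (S.equivariant.lTensor.comp
      equivariant_assoc)) (S'.equivariant.comp S'.equivariant.rTensor)).comp_right
      ((equivariant_tensorTensorTensorComm (ρU := ρ.tprod ρ) (ρV := ρ'.tprod ρ') (ρW := ρ)
        (ρX := ρ')).comp (equivariant_tensorTensorTensorComm.rTensor (ρX := ρ.tprod ρ')))
    convert h using 1
    · ext v w v' w' v'' w''; rfl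
    · ext v w v' w' v'' w''; rfl
  comm := by
    have h := (S.comm.map S'.comm S.equivariant (S'.equivariant.comp equivariant_comm)).comp_right
      (equivariant_tensorTensorTensorComm (ρU := ρ) (ρV := ρ') (ρW := ρ) (ρX := ρ'))
    convert h using 1
    · ext v w v' w'; rfl
    · rfl
  one_mul := by
    have h := S.one_mul.map S'.one_mul Equivariant.id
      (S'.equivariant.comp (equivariant_mk S'.one_mem))
    convert h using 1
    · ext v w; rfl
    · ext v w; rfl

theorem mul_one (S : IsStableCommRing ρ m o) :
    StableEq ρ ρ (m ∘ₗ (TensorProduct.mk k V V).flip o) LinearMap.id :=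
  ((S.comm.comp_right (equivariant_mk S.one_mem))).trans S.one_mul

theorem mul_mem (S : IsStableCommRing ρ m o) {v w : V} (hv : v ∈ ρ.invariants)
    (hw : w ∈ ρ.invariants) : m (v ⊗ₜ w) ∈ ρ.invariants :=
  S.equivariant.mem_invariants (tmul_mem_invariants hv hw)

/-- The ring of invariants modulo norms. -/
def Ring (_ : IsStableCommRing ρ m o) : Type := TateZero ρ

noncomputable instance (S : IsStableCommRing ρ m o) : AddCommGroup S.Ring :=
  inferInstanceAs (AddCommGroup (TateZero ρ))

noncomputable instance (S : IsStableCommRing ρ m o) : Module k S.Ring :=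
  inferInstanceAs (Module k (TateZero ρ))

/-- The class of an invariant element. -/
noncomputable def cls (S : IsStableCommRing ρ m o) : ρ.invariants →ₗ[k] S.Ring :=
  Submodule.mkQ ((LinearMap.range ρ.norm).comap ρ.invariants.subtype)

theorem cls_surjective (S : IsStableCommRing ρ m o) : Function.Surjective S.cls :=
  Submodule.mkQ_surjective _

theorem cls_eq_zero_iff (S : IsStableCommRing ρ m o) (v : ρ.invariants) :
    S.cls v = 0 ↔ ∃ u, (v : V) = ρ.norm u := by
  refine (Submodule.Quotient.mk_eq_zero _).trans ?_
  simp [eq_comm]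

theorem cls_eq_iff (S : IsStableCommRing ρ m o) (v w : ρ.invariants) :
    S.cls v = S.cls w ↔ ∃ u, (v : V) = w + ρ.norm u := by
  rw [← sub_eq_zero, ← map_sub, cls_eq_zero_iff]
  simp [sub_eq_iff_eq_add']

/-- The product on invariant elements. -/
noncomputable def invMul (S : IsStableCommRing ρ m o) :
    ρ.invariants →ₗ[k] ρ.invariants →ₗ[k] ρ.invariants :=
  LinearMap.mk₂ k (fun v w => ⟨m ((v : V) ⊗ₜ (w : V)), S.mul_mem v.2 w.2⟩)
    (fun _ _ _ => Subtype.ext (by simp [TensorProduct.add_tmul]))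
    (fun _ _ _ => Subtype.ext (by simp [← TensorProduct.smul_tmul']))
    (fun _ _ _ => Subtype.ext (by simp [TensorProduct.tmul_add]))
    (fun _ _ _ => Subtype.ext (by simp))

@[simp]
theorem coe_invMul (S : IsStableCommRing ρ m o) (v w : ρ.invariants) :
    (S.invMul v w : V) = m ((v : V) ⊗ₜ (w : V)) := rfl

/-- The product of the ring of invariants modulo norms, as a bilinear map. -/
noncomputable def ringMul (S : IsStableCommRing ρ m o) : S.Ring →ₗ[k] S.Ring →ₗ[k] S.Ring :=
  Submodule.liftQ _ ((Submodule.liftQ _ (S.invMul.compr₂ S.cls).flip (by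
    rintro ⟨_, hw⟩ ⟨w, rfl⟩
    ext v
    refine (S.cls_eq_zero_iff _).2 ⟨m ((v : V) ⊗ₜ w), ?_⟩
    rw [← S.equivariant.apply_norm, norm_tprod_tmul_left v.2]
    rfl)).flip) (by
    rintro ⟨_, hv⟩ ⟨v, rfl⟩
    refine Submodule.linearMap_qext _ (LinearMap.ext fun w => ?_)
    refine (S.cls_eq_zero_iff _).2 ⟨m (v ⊗ₜ (w : V)), ?_⟩
    rw [← S.equivariant.apply_norm, norm_tprod_tmul_right v w.2]
    rfl)

noncomputable instance (S : IsStableCommRing ρ m o) : CommRing S.Ring :=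
  { (inferInstance : AddCommGroup S.Ring) with
    mul x y := S.ringMul x y
    one := S.cls ⟨o, S.one_mem⟩
    left_distrib x y z := map_add (S.ringMul x) y z
    right_distrib x y z := LinearMap.map_add₂ S.ringMul x y z
    zero_mul x := LinearMap.map_zero₂ S.ringMul x
    mul_zero x := map_zero (S.ringMul x)
    mul_assoc x y z := by
      obtain ⟨u, rfl⟩ := S.cls_surjective x
      obtain ⟨v, rfl⟩ := S.cls_surjective y
      obtain ⟨w, rfl⟩ := S.cls_surjective z
      refine (S.cls_eq_iff _ _).2 ?_
      simpa using S.assoc.exists_norm (tmul_mem_invariants (tmul_mem_invariants u.2 v.2) w.2)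
    mul_comm x y := by
      obtain ⟨u, rfl⟩ := S.cls_surjective x
      obtain ⟨v, rfl⟩ := S.cls_surjective y
      refine (S.cls_eq_iff _ _).2 ?_
      simpa using S.comm.exists_norm (tmul_mem_invariants v.2 u.2)
    one_mul x := by
      obtain ⟨u, rfl⟩ := S.cls_surjective x
      refine (S.cls_eq_iff _ _).2 ?_
      simpa using S.one_mul.exists_norm u.2
    mul_one x := by
      obtain ⟨u, rfl⟩ := S.cls_surjective x
      refine (S.cls_eq_iff _ _).2 ?_
      simpa using S.mul_one.exists_norm u.2 }

noncomputable instance (S : IsStableCommRing ρ m o) : Algebra k S.Ring :=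
  Algebra.ofModule (fun c x y => LinearMap.map_smul₂ S.ringMul c x y)
    (fun c x y => map_smul (S.ringMul x) c y)

theorem cls_mul (S : IsStableCommRing ρ m o) (v w : ρ.invariants) :
    S.cls v * S.cls w = S.cls (S.invMul v w) := rfl

theorem cls_one (S : IsStableCommRing ρ m o) : S.cls ⟨o, S.one_mem⟩ = 1 := rfl

end IsStableCommRing

theorem StableTTRing.mk_one_comp {ρ : Representation k G V} (T : StableTTRing ρ) :
    T.one.rTensor V ∘ₗ (TensorProduct.lid k V).symm.toLinearMap =
      TensorProduct.mk k V V (T.one 1) := by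
  ext v; simp

theorem StableTTRing.one_mem {ρ : Representation k G V} (T : StableTTRing ρ) :
    T.one 1 ∈ ρ.invariants := fun g => by
  rw [← T.one_equivariant.apply]; simp

theorem StableTTRing.isStableCommRing {ρ : Representation k G V} (T : StableTTRing ρ) :
    IsStableCommRing ρ T.mul (T.one 1) where
  equivariant := T.mul_equivariant
  one_mem := T.one_mem
  assoc := stablyTrivial_iff_isTrace.1 T.assoc
  comm := stablyTrivial_iff_isTrace.1 T.mul_comm
  one_mul := by
    rw [← T.mk_one_comp]
    exact stablyTrivial_iff_isTrace.1 T.one_mul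

end StableRing

theorem isIdempotentElem_eq_of_sum_eq_zero {R ι : Type*} [CommRing R] [Fintype ι] {p : ℕ}
    (hp : p.Prime) (hR : (p : R) = 0) (hι : Fintype.card ι = p) {E : ι → R}
    (hE : ∀ i, IsIdempotentElem (E i)) (hsum : ∑ i, E i = 0) (i j : ι) : E i = E j := by
  classical
  have hcube : (E i - E j) ^ 3 = E i - E j := by
    have hi : E i * E i = E i := hE i
    have hj : E j * E j = E j := hE j
    linear_combination (E i + 1 - 3 * E j) * hi + (3 * E i - E j - 1) * hj
  have hnil : IsNilpotent (E i - E j) := by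
    rw [nilpotent_iff_mem_prime]
    intro P hP
    rw [← Ideal.Quotient.eq_zero_iff_mem, map_sub, sub_eq_zero]
    have hq (l : ι) : Ideal.Quotient.mk P (E l) = 0 ∨ Ideal.Quotient.mk P (E l) = 1 :=
      IsIdempotentElem.iff_eq_zero_or_one.1 ((hE l).map (Ideal.Quotient.mk P))
    have : Fact p.Prime := ⟨hp⟩
    have hchar : CharP (R ⧸ P) p :=
      (CharP.charP_iff_prime_eq_zero hp).2 (by
        rw [← map_natCast (Ideal.Quotient.mk P), hR, map_zero])
    have hcount : p ∣ (Finset.univ.filter fun l => Ideal.Quotient.mk P (E l) = 1).card := by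
      have h0 := congr_arg (Ideal.Quotient.mk P) hsum
      rw [map_sum, map_zero] at h0
      rw [← CharP.cast_eq_zero_iff (R ⧸ P), ← Finset.sum_boole]
      refine (Finset.sum_congr rfl fun l _ => ?_).trans h0
      rcases hq l with h | h <;> simp [h]
    have hle := Finset.card_le_univ (Finset.univ.filter fun l => Ideal.Quotient.mk P (E l) = 1)
    rw [hι] at hle
    rcases Nat.eq_zero_or_pos
      (Finset.univ.filter fun l => Ideal.Quotient.mk P (E l) = 1).card with h | h
    · rw [Finset.card_eq_zero, Finset.filter_eq_empty_iff] at h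
      rw [(hq i).resolve_right (h (Finset.mem_univ i)),
        (hq j).resolve_right (h (Finset.mem_univ j))]
    · have h1 := (le_antisymm hle (Nat.le_of_dvd h hcount)).trans hι.symm
      rw [Finset.card_eq_iff_eq_univ, Finset.filter_eq_self] at h1
      rw [h1 i (Finset.mem_univ i), h1 j (Finset.mem_univ j)]
  obtain ⟨n, hn⟩ := hnil
  have hpow (l : ℕ) : (E i - E j) ^ (2 * l + 1) = E i - E j := by
    induction l with
    | zero => simp
    | succ l ih =>
      rw [show 2 * (l + 1) + 1 = 2 * l + 1 + 2 by ring, pow_add, ih, ← pow_succ', hcube]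
  rw [← sub_eq_zero, ← hpow n, pow_eq_zero_of_le (by omega) hn]

section Separability

variable {k G : Type} [Field k] [Group G] [Fintype G]
variable {V : Type} [AddCommGroup V] [Module k V] {ρ : Representation k G V}

/-- The map `a ↦ ∑ (a * e₁) ⊗ e₂`. -/
noncomputable def leftAct (m : V ⊗[k] V →ₗ[k] V) (e : V ⊗[k] V) : V →ₗ[k] V ⊗[k] V :=
  m.rTensor V ∘ₗ (TensorProduct.assoc k V V V).symm.toLinearMap ∘ₗ
    (TensorProduct.mk k V (V ⊗[k] V)).flip e

/-- The map `a ↦ ∑ e₁ ⊗ (e₂ * a)`. -/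
noncomputable def rightAct (m : V ⊗[k] V →ₗ[k] V) (e : V ⊗[k] V) : V →ₗ[k] V ⊗[k] V :=
  m.lTensor V ∘ₗ (TensorProduct.assoc k V V V).toLinearMap ∘ₗ TensorProduct.mk k (V ⊗[k] V) V e

theorem leftAct_tmul (m : V ⊗[k] V →ₗ[k] V) (u v a : V) :
    leftAct m (u ⊗ₜ v) a = m (a ⊗ₜ u) ⊗ₜ v := rfl

theorem rightAct_tmul (m : V ⊗[k] V →ₗ[k] V) (u v a : V) :
    rightAct m (u ⊗ₜ v) a = u ⊗ₜ m (v ⊗ₜ a) := rfl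

theorem leftAct_add (m : V ⊗[k] V →ₗ[k] V) (e e' : V ⊗[k] V) :
    leftAct m (e + e') = leftAct m e + leftAct m e' := by
  simp [leftAct, LinearMap.comp_add]

theorem rightAct_add (m : V ⊗[k] V →ₗ[k] V) (e e' : V ⊗[k] V) :
    rightAct m (e + e') = rightAct m e + rightAct m e' := by
  simp [rightAct, LinearMap.comp_add]

theorem leftAct_zero (m : V ⊗[k] V →ₗ[k] V) : leftAct m 0 = 0 := by simp [leftAct]

theorem rightAct_zero (m : V ⊗[k] V →ₗ[k] V) : rightAct m 0 = 0 := by simp [rightAct]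

theorem leftAct_lTensor (m : V ⊗[k] V →ₗ[k] V) (f : V →ₗ[k] V) (e : V ⊗[k] V) (a : V) :
    leftAct m (f.lTensor V e) a = f.lTensor V (leftAct m e a) := by
  induction e with
  | zero => simp [leftAct_zero]
  | tmul u v => rfl
  | add e e' h h' => simp only [map_add, leftAct_add, LinearMap.add_apply, h, h']

theorem rTensor_mul_mk (m : V ⊗[k] V →ₗ[k] V) (e : V ⊗[k] V) (a : V) :
    (m ∘ₗ TensorProduct.mk k V V a).rTensor V e = leftAct m e a := by
  induction e with
  | zero => simp [leftAct_zero]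
  | tmul u v => rfl
  | add e e' h h' => simp only [map_add, leftAct_add, LinearMap.add_apply, h, h']

theorem lTensor_mul_mk_flip (m : V ⊗[k] V →ₗ[k] V) (e : V ⊗[k] V) (a : V) :
    (m ∘ₗ (TensorProduct.mk k V V).flip a).lTensor V e = rightAct m e a := by
  induction e with
  | zero => simp [rightAct_zero]
  | tmul u v => rfl
  | add e e' h h' => simp only [map_add, rightAct_add, LinearMap.add_apply, h, h']

theorem tensorMul_tmul_left (m : V ⊗[k] V →ₗ[k] V) (e : V ⊗[k] V) (a b : V) :
    tensorMul m m ((a ⊗ₜ b) ⊗ₜ e) = (m ∘ₗ (TensorProduct.comm k V V).toLinearMap).lTensor V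
      (TensorProduct.assoc k V V V (leftAct m e a ⊗ₜ b)) := by
  induction e with
  | zero => simp [leftAct_zero]
  | tmul u v => rfl
  | add e e' h h' =>
    simp only [map_add, leftAct_add, LinearMap.add_apply, TensorProduct.add_tmul,
      TensorProduct.tmul_add, h, h']

theorem lTensor_mul_rightAct (m : V ⊗[k] V →ₗ[k] V) (e : V ⊗[k] V) (a b : V) :
    (m ∘ₗ m.rTensor V).lTensor V (TensorProduct.assoc k V (V ⊗[k] V) V
      (TensorProduct.assoc k V V V (e ⊗ₜ a) ⊗ₜ b)) =
      m.lTensor V (TensorProduct.assoc k V V V (rightAct m e a ⊗ₜ b)) := by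
  induction e with
  | zero => simp [rightAct_zero]
  | tmul u v => rfl
  | add e e' h h' =>
    simp only [map_add, rightAct_add, LinearMap.add_apply, TensorProduct.add_tmul, h, h']

theorem rightAct_mul (m : V ⊗[k] V →ₗ[k] V) (e : V ⊗[k] V) (a b : V) :
    (m ∘ₗ m.lTensor V ∘ₗ (TensorProduct.assoc k V V V).toLinearMap).lTensor V
      (TensorProduct.assoc k V (V ⊗[k] V) V (TensorProduct.assoc k V V V (e ⊗ₜ a) ⊗ₜ b)) =
      rightAct m e (m (a ⊗ₜ b)) := by
  induction e with
  | zero => simp [rightAct_zero]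
  | tmul u v => rfl
  | add e e' h h' =>
    simp only [map_add, rightAct_add, LinearMap.add_apply, TensorProduct.add_tmul, h, h']

theorem rightAct_equivariant_apply {m : V ⊗[k] V →ₗ[k] V} (hm : Equivariant (ρ.tprod ρ) ρ m)
    (g : G) (e : V ⊗[k] V) (a : V) :
    m.lTensor V (TensorProduct.assoc k V V V ((ρ g).lTensor V e ⊗ₜ ρ g a)) =
      (ρ g).lTensor V (rightAct m e a) := by
  induction e with
  | zero => simp [rightAct_zero]
  | tmul u v => simp [rightAct_tmul, ← hm.apply]
  | add e e' h₁ h₂ =>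
    simp only [map_add, rightAct_add, LinearMap.add_apply, TensorProduct.add_tmul, h₁, h₂]

/-- An invariant element witnessing the separability of a multiplication, up to traces. -/
structure IsSeparabilityElement (ρ : Representation k G V) (m : V ⊗[k] V →ₗ[k] V)
    (e : V ⊗[k] V) : Prop where
  mem : e ∈ (ρ.tprod ρ).invariants
  slide : StableEq ρ (ρ.tprod ρ) (leftAct m e) (rightAct m e)
  mul_leftAct : StableEq ρ ρ (m ∘ₗ leftAct m e) LinearMap.id

theorem StableTTRing.isSeparabilityElement (T : StableTTRing ρ) :
    IsSeparabilityElement ρ T.mul (T.sec (T.one 1)) := by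
  have S := T.isStableCommRing
  have hl : StableEq ρ (ρ.tprod ρ) (leftAct T.mul (T.sec (T.one 1))) T.sec :=
    (StableEq.comp_right (stablyTrivial_iff_isTrace.1 T.sec_left)
      (equivariant_mk_flip S.one_mem)).trans (S.mul_one.comp_left T.sec_equivariant)
  have hr : StableEq ρ (ρ.tprod ρ) (rightAct T.mul (T.sec (T.one 1))) T.sec :=
    (StableEq.comp_right (stablyTrivial_iff_isTrace.1 T.sec_right)
      (equivariant_mk S.one_mem)).trans (S.one_mul.comp_left T.sec_equivariant)
  exact ⟨T.sec_equivariant.mem_invariants S.one_mem, hl.trans hr.symm,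
    (hl.comp_left T.mul_equivariant).trans (stablyTrivial_iff_isTrace.1 T.sep)⟩

namespace IsSeparabilityElement

variable {m : V ⊗[k] V →ₗ[k] V} {o : V} {e : V ⊗[k] V}

theorem leftAct_one (S : IsStableCommRing ρ m o) (he : e ∈ (ρ.tprod ρ).invariants) :
    ∃ w, leftAct m e o = e + (ρ.tprod ρ).norm w := by
  simpa [rTensor_mul_mk] using (S.one_mul.rTensor (ρX := ρ)).exists_norm he

theorem rightAct_one (S : IsStableCommRing ρ m o) (he : e ∈ (ρ.tprod ρ).invariants) :
    ∃ w, rightAct m e o = e + (ρ.tprod ρ).norm w := by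
  simpa [lTensor_mul_mk_flip] using (S.mul_one.lTensor (ρX := ρ)).exists_norm he

theorem mul_eq_one (H : IsSeparabilityElement ρ m e) (S : IsStableCommRing ρ m o) :
    ∃ u, m e = o + ρ.norm u := by
  obtain ⟨u, hu⟩ := H.mul_leftAct.exists_norm S.one_mem
  obtain ⟨w, hw⟩ := leftAct_one S H.mem
  refine ⟨u - m w, ?_⟩
  rw [LinearMap.comp_apply, hw, map_add, S.equivariant.apply_norm, LinearMap.id_apply] at hu
  rw [map_sub, ← add_sub_assoc, ← hu, add_sub_cancel_right]

theorem equivariant_rightAct (S : IsStableCommRing ρ m o) (he : e ∈ (ρ.tprod ρ).invariants) :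
    Equivariant ρ (ρ.tprod ρ) (rightAct m e) :=
  S.equivariant.lTensor.comp (equivariant_assoc.comp (equivariant_mk he))

theorem equivariant_leftAct (S : IsStableCommRing ρ m o) (he : e ∈ (ρ.tprod ρ).invariants) :
    Equivariant ρ (ρ.tprod ρ) (leftAct m e) :=
  S.equivariant.rTensor.comp (equivariant_assoc_symm.comp (equivariant_mk_flip he))

theorem tensorMul_flip (H : IsSeparabilityElement ρ m e) (S : IsStableCommRing ρ m o) :
    StableEq (ρ.tprod ρ) (ρ.tprod ρ) (tensorMul m m ∘ₗ (TensorProduct.mk k _ _).flip e)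
      (rightAct m e ∘ₗ m) := by
  have h0 : tensorMul m m ∘ₗ (TensorProduct.mk k _ _).flip e =
      (m ∘ₗ (TensorProduct.comm k V V).toLinearMap).lTensor V ∘ₗ
        (TensorProduct.assoc k V V V).toLinearMap ∘ₗ (leftAct m e).rTensor V :=
    TensorProduct.ext' fun a b => tensorMul_tmul_left m e a b
  have h1 : (m ∘ₗ m.rTensor V).lTensor V ∘ₗ (TensorProduct.assoc k V (V ⊗[k] V) V).toLinearMap ∘ₗ
      ((TensorProduct.assoc k V V V).toLinearMap ∘ₗ TensorProduct.mk k (V ⊗[k] V) V e).rTensor V =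
      m.lTensor V ∘ₗ (TensorProduct.assoc k V V V).toLinearMap ∘ₗ (rightAct m e).rTensor V :=
    TensorProduct.ext' fun a b => lTensor_mul_rightAct m e a b
  have h2 : (m ∘ₗ m.lTensor V ∘ₗ (TensorProduct.assoc k V V V).toLinearMap).lTensor V ∘ₗ
      (TensorProduct.assoc k V (V ⊗[k] V) V).toLinearMap ∘ₗ
      ((TensorProduct.assoc k V V V).toLinearMap ∘ₗ TensorProduct.mk k (V ⊗[k] V) V e).rTensor V =
      rightAct m e ∘ₗ m :=
    TensorProduct.ext' fun a b => rightAct_mul m e a b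
  rw [h0, ← h2]
  refine ((S.comm.lTensor).comp_right
    (equivariant_assoc.comp (equivariant_leftAct S H.mem).rTensor)).trans ?_
  refine ((H.slide.rTensor.comp_left equivariant_assoc).comp_left S.equivariant.lTensor).trans ?_
  rw [← h1]
  exact S.assoc.lTensor.comp_right (equivariant_assoc.comp
    (equivariant_assoc.comp (equivariant_mk H.mem)).rTensor)

theorem isIdempotent (H : IsSeparabilityElement ρ m e) (S : IsStableCommRing ρ m o) :
    ∃ w, tensorMul m m (e ⊗ₜ e) = e + (ρ.tprod ρ).norm w := by
  obtain ⟨w, hw⟩ := (H.tensorMul_flip S).exists_norm H.mem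
  obtain ⟨u, hu⟩ := H.mul_eq_one S
  obtain ⟨w', hw'⟩ := rightAct_one S H.mem
  refine ⟨w' + rightAct m e u + w, ?_⟩
  simp only [LinearMap.comp_apply, LinearMap.flip_apply, TensorProduct.mk_apply, hu, map_add,
    hw', (equivariant_rightAct S H.mem).apply_norm] at hw ⊢
  rw [hw]
  abel

variable {p : ℕ} [Fact p.Prime] [CharP k p]

theorem lTensor_apply (H : IsSeparabilityElement ρ m e) (S : IsStableCommRing ρ m o)
    (hcomm : ∀ a b : G, a * b = b * a) (hcard : Fintype.card G = p) (g : G) :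
    ∃ w, (ρ g).lTensor V e = e + (ρ.tprod ρ).norm w := by
  have hρ (g : G) : Equivariant ρ ρ (ρ g) := .of_apply fun h v => by
    rw [← Module.End.mul_apply, ← map_mul, hcomm, map_mul, Module.End.mul_apply]
  let E (g : G) : (ρ.tprod ρ).invariants :=
    ⟨(ρ g).lTensor V e, (hρ g).lTensor.mem_invariants H.mem⟩
  let S2 := S.tensor S
  have hmul (g : G) (z z' : V ⊗[k] V) : tensorMul m m ((ρ g).lTensor V z ⊗ₜ (ρ g).lTensor V z') =
      (ρ g).lTensor V (tensorMul m m (z ⊗ₜ z')) := by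
    have : tensorMul m m ∘ₗ TensorProduct.map ((ρ g).lTensor V) ((ρ g).lTensor V) =
        (ρ g).lTensor V ∘ₗ tensorMul m m := by
      ext a b a' b'
      simp [← S.equivariant.apply]
    exact LinearMap.congr_fun this (z ⊗ₜ z')
  have hidem (g : G) : IsIdempotentElem (S2.cls (E g)) := by
    obtain ⟨w, hw⟩ := H.isIdempotent S
    refine (S2.cls_eq_iff _ _).2 ⟨(ρ g).lTensor V w, ?_⟩
    simp only [IsStableCommRing.coe_invMul, E, hmul, hw, map_add, (hρ g).lTensor.apply_norm]
  have hsum : ∑ g, S2.cls (E g) = 0 := by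
    rw [← map_sum]
    obtain ⟨w, hw⟩ := ((IsTrace.of_norm ρ).map_right (ρX := ρ) Equivariant.id).exists_norm H.mem
    refine (S2.cls_eq_zero_iff _).2 ⟨w, ?_⟩
    rw [← hw]
    change _ = ρ.norm.lTensor V e
    have h := map_sum (LinearMap.lTensorHom V) (fun g => ρ g) Finset.univ
    simp only [LinearMap.coe_lTensorHom] at h
    simp [E, Representation.norm, h]
  have hR : (p : S2.Ring) = 0 := by
    rw [← map_natCast (algebraMap k S2.Ring), CharP.cast_eq_zero, map_zero]
  have := isIdempotentElem_eq_of_sum_eq_zero Fact.out hR hcard hidem hsum g 1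
  simpa [E, Module.End.one_eq_id] using (S2.cls_eq_iff _ _).1 this

/-- The group acts trivially up to traces. -/
theorem stableEq_id (H : IsSeparabilityElement ρ m e) (S : IsStableCommRing ρ m o)
    (hcomm : ∀ a b : G, a * b = b * a) (hcard : Fintype.card G = p) (g : G) :
    StableEq ρ ρ (ρ g) LinearMap.id := by
  have hρ : Equivariant ρ ρ (ρ g) := .of_apply fun h v => by
    rw [← Module.End.mul_apply, ← map_mul, hcomm, map_mul, Module.End.mul_apply]
  obtain ⟨w, hw⟩ := H.lTensor_apply S hcomm hcard g
  obtain ⟨u, hu⟩ := H.mul_eq_one S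
  have h1 : StableEq ρ ρ (m ∘ₗ (ρ g).lTensor V ∘ₗ leftAct m e) LinearMap.id := by
    refine StableEq.trans ?_ H.mul_leftAct
    have : (ρ g).lTensor V ∘ₗ leftAct m e =
        leftAct m e + leftAct m ((ρ.tprod ρ).norm w) := by
      ext a
      rw [LinearMap.comp_apply, ← leftAct_lTensor, hw, leftAct_add]
    rw [this]
    refine StableEq.comp_left ?_ S.equivariant
    unfold StableEq
    rw [add_sub_cancel_left]
    exact ((IsTrace.mk_flip_norm w).comp_left equivariant_assoc_symm).comp_left
      S.equivariant.rTensor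
  have h2 : StableEq ρ ρ (m ∘ₗ (ρ g).lTensor V ∘ₗ rightAct m e) (ρ g) := by
    have h3 : m ∘ₗ (ρ g).lTensor V ∘ₗ rightAct m e =
        (m ∘ₗ m.lTensor V ∘ₗ (TensorProduct.assoc k V V V).toLinearMap) ∘ₗ
          TensorProduct.mk k (V ⊗[k] V) V ((ρ g).lTensor V e) ∘ₗ ρ g := by
      ext a
      simp only [LinearMap.comp_apply, LinearEquiv.coe_coe, TensorProduct.mk_apply,
        rightAct_equivariant_apply S.equivariant]
    have h4 : (m ∘ₗ m.rTensor V) ∘ₗ TensorProduct.mk k (V ⊗[k] V) V ((ρ g).lTensor V e) =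
        m ∘ₗ TensorProduct.mk k V V o + m ∘ₗ TensorProduct.mk k V V (ρ.norm (u + m w)) := by
      rw [hw, map_add, map_add, LinearMap.comp_add]
      ext a
      simp [hu, S.equivariant.apply_norm, TensorProduct.add_tmul, add_assoc]
    rw [h3]
    refine (S.assoc.symm.comp_right
      ((equivariant_mk (hρ.lTensor.mem_invariants H.mem)).comp hρ)).trans ?_
    rw [← LinearMap.comp_assoc, h4]
    refine (StableEq.comp_right (f' := LinearMap.id) ?_ hρ)
    have h5 := S.one_mul.add (StableEq.comp_left (e := m) (f' := 0)
      (by simpa [StableEq] using IsTrace.mk_norm (ρV := ρ) (ρU := ρ) (u + m w)) S.equivariant)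
    simpa using h5
  exact (h2.symm.trans
    ((H.slide.symm.comp_left hρ.lTensor).comp_left S.equivariant)).trans h1

end IsSeparabilityElement

end Separability

section Jordan

variable {k V : Type} [Field k] [AddCommGroup V] [Module k V]

theorem LinearIndependent.sumElim_of_map {κ l : Type*} {x : V →ₗ[k] V} {W : Submodule k V}
    {u : κ → V} {w : l → V} (hu : LinearIndependent k u) (hw : LinearIndependent k (x ∘ w))
    (hu' : Submodule.span k (Set.range u) = W ⊓ LinearMap.ker x)
    (hw' : Submodule.span k (Set.range w) ≤ W)
    (hxw : Submodule.span k (Set.range (x ∘ w)) = W.map x) :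
    LinearIndependent k (Sum.elim u w) ∧
      Submodule.span k (Set.range (Sum.elim u w)) = W := by
  constructor
  · refine hu.sum_type (.of_comp x hw) ?_
    rw [hu']
    exact (Submodule.range_ker_disjoint hw).symm.mono_left inf_le_right
  · rw [Set.Sum.elim_range, Submodule.span_union, hu', sup_comm, inf_comm,
      ← sup_inf_assoc_of_le _ hw', ← Submodule.comap_map_eq, Submodule.map_span,
      ← Set.range_comp, hxw, inf_eq_right]
    exact Submodule.le_comap_map x W

/-- A nilpotent endomorphism has a basis of Jordan chains. -/
theorem exists_jordan_chains (x : Module.End k V) (m : ℕ) (W : Submodule k V)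
    (hW : W.map x ≤ W) (hm : ∀ w ∈ W, (x ^ m) w = 0) :
    ∃ (ι : Type) (n : ι → ℕ) (a : ι → V), (∀ i, (x ^ (n i + 1)) (a i) = 0) ∧
      LinearIndependent k (fun q : Σ i, Fin (n i + 1) => (x ^ (q.2 : ℕ)) (a q.1)) ∧
      Submodule.span k (Set.range fun q : Σ i, Fin (n i + 1) => (x ^ (q.2 : ℕ)) (a q.1)) = W := by
  induction m generalizing W with
  | zero =>
    refine ⟨Empty, nofun, nofun, nofun, linearIndependent_empty_type, ?_⟩
    rw [Set.range_eq_empty, Submodule.span_empty]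
    exact ((Submodule.eq_bot_iff _).2 fun w hw => by simpa using hm w hw).symm
  | succ m ih =>
    obtain ⟨ι, n, a, ha, hli, hspan⟩ := ih (W.map x) (Submodule.map_mono hW) (by
      rintro _ ⟨w, hw, rfl⟩
      rw [← Module.End.mul_apply, ← pow_succ]
      exact hm w hw)
    have haW (i : ι) : ∃ v ∈ W, x v = a i := by
      have : a i ∈ W.map x := hspan ▸ Submodule.subset_span ⟨⟨i, 0⟩, by simp⟩
      simpa using this
    choose b hbW hb using haW
    have hxb (i : ι) (j : ℕ) : x ((x ^ j) (b i)) = (x ^ j) (a i) := by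
      rw [← hb, ← Module.End.mul_apply, ← pow_succ', pow_succ, Module.End.mul_apply]
    have hpow (j : ℕ) {v : V} (hv : v ∈ W) : (x ^ j) v ∈ W := by
      induction j with
      | zero => simpa
      | succ j ihj =>
        rw [pow_succ', Module.End.mul_apply]
        exact hW ⟨_, ihj, rfl⟩
    let last (i : ι) : V := (x ^ (n i + 1)) (b i)
    have hlast : LinearIndependent k last := by
      have h := hli.comp (fun i => ⟨i, Fin.last (n i)⟩) fun i i' h => (Sigma.mk.inj_iff.1 h).1
      have hl : last = (fun q : Σ i, Fin (n i + 1) => (x ^ (q.2 : ℕ)) (a q.1)) ∘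
          fun i => ⟨i, Fin.last (n i)⟩ := funext fun i => by simp [last, pow_succ, hb]
      rwa [hl]
    have hlast' : Submodule.span k (Set.range last) ≤ W ⊓ LinearMap.ker x := by
      rw [Submodule.span_le]
      rintro _ ⟨i, rfl⟩
      exact ⟨hpow _ (hbW i), (hxb i _).trans (ha i)⟩
    obtain ⟨C, hC⟩ := exists_isCompl (Submodule.span k (Set.range last))
    let C' : Submodule k V := C ⊓ (W ⊓ LinearMap.ker x)
    let B := Module.Basis.ofVectorSpace k C'
    have hB : LinearIndependent k (fun e => (B e : V)) :=
      B.linearIndependent.map' C'.subtype C'.ker_subtype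
    have hBspan : Submodule.span k (Set.range fun e => (B e : V)) = C' := by
      have h := congr_arg (Submodule.map C'.subtype) B.span_eq
      rwa [Submodule.map_span, ← Set.range_comp, Submodule.map_top, Submodule.range_subtype] at h
    have hu : LinearIndependent k (Sum.elim last fun e => (B e : V)) :=
      hlast.sum_type hB (by rw [hBspan]; exact hC.disjoint.mono_right inf_le_left)
    have hu' : Submodule.span k (Set.range (Sum.elim last fun e => (B e : V))) =
        W ⊓ LinearMap.ker x := by
      rw [Set.Sum.elim_range, Submodule.span_union, hBspan, ← sup_inf_assoc_of_le _ hlast',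
        hC.sup_eq_top, top_inf_eq]
    let w (q : Σ i, Fin (n i + 1)) : V := (x ^ (q.2 : ℕ)) (b q.1)
    have hxw : x ∘ w = fun q : Σ i, Fin (n i + 1) => (x ^ (q.2 : ℕ)) (a q.1) :=
      funext fun q => hxb _ _
    obtain ⟨h1, h2⟩ := hu.sumElim_of_map (W := W) (x := x) (w := w) (hxw ▸ hli) hu'
      (Submodule.span_le.2 (by rintro _ ⟨q, rfl⟩; exact hpow _ (hbW _))) (hxw ▸ hspan)
    let len : ι ⊕ Module.Basis.ofVectorSpaceIndex k C' → ℕ := Sum.elim (fun i => n i + 1) fun _ => 0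
    let top : ι ⊕ Module.Basis.ofVectorSpaceIndex k C' → V := Sum.elim b fun e => (B e : V)
    let F : (ι ⊕ Module.Basis.ofVectorSpaceIndex k C') ⊕ (Σ i, Fin (n i + 1)) →
        Σ s, Fin (len s + 1) := Sum.elim (Sum.elim (fun i => ⟨Sum.inl i, Fin.last (n i + 1)⟩)
          fun e => ⟨Sum.inr e, (0 : Fin 1)⟩) fun q => ⟨Sum.inl q.1, q.2.castSucc⟩
    have hF : Function.Bijective F := by
      constructor
      · rintro ((i | e) | ⟨i, j⟩) ((i' | e') | ⟨i', j'⟩) h <;>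
          obtain ⟨h1, h2⟩ := Sigma.mk.inj_iff.1 h <;> cases h1 <;>
          have h3 := congr_arg Fin.val (eq_of_heq h2) <;> first
            | rfl
            | exact absurd h3 (by simp; omega)
            | exact congr_arg Sum.inr (congr_arg _ (Fin.ext h3))
      · rintro ⟨i | e, j⟩
        · induction j using Fin.lastCases with
          | last => exact ⟨Sum.inl (Sum.inl i), rfl⟩
          | cast j => exact ⟨Sum.inr ⟨i, j⟩, rfl⟩
        · exact ⟨Sum.inl (Sum.inr e),
            Sigma.ext rfl (heq_of_eq (Subsingleton.elim (α := Fin 1) _ _))⟩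
    have hv : (fun q : Σ s, Fin (len s + 1) => (x ^ (q.2 : ℕ)) (top q.1)) ∘ F =
        Sum.elim (Sum.elim last fun e => (B e : V)) w := by
      ext ((i | e) | q) <;> simp [F, top, last, w]
    refine ⟨_, len, top, ?_, ?_, ?_⟩
    · rintro (i | e)
      · change (x ^ (n i + 1 + 1)) (b i) = 0
        rw [pow_succ, Module.End.mul_apply, hb, ha]
      · simpa [len, top] using (LinearMap.mem_ker.1 (B e).2.2.2)
    · rw [← linearIndependent_equiv (Equiv.ofBijective F hF)]
      exact hv ▸ h1
    · rw [← h2, ← hv, Set.range_comp, hF.surjective.range_eq, Set.image_univ]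

end Jordan

section Cyclic

open Polynomial in
theorem sum_range_X_pow_eq {k : Type} [Field k] (p : ℕ) [hp : Fact p.Prime] [CharP k p] :
    ∑ i ∈ Finset.range p, (X : k[X]) ^ i = (X - 1) ^ (p - 1) := by
  have h : (X - 1 : k[X]) ≠ 0 := X_sub_C_ne_zero 1
  apply mul_right_cancel₀ h
  rw [geom_sum_mul, ← pow_succ, Nat.sub_add_cancel hp.out.one_le, sub_pow_char, one_pow]

open Polynomial in
theorem sum_range_mul_X_pow_eq {k : Type} [Field k] (p : ℕ) [Fact p.Prime] [CharP k p] :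
    ∑ i ∈ Finset.range p, (i : k[X]) * (X : k[X]) ^ i =
      (X - 1) ^ (p - 2) * (X * ((p - 1 : ℕ) : k[X])) := by
  have h := congr_arg (fun f => X * derivative f) (sum_range_X_pow_eq (k := k) p)
  rw [← C_1 (R := k)] at h
  simp only [derivative_sum, derivative_X_pow, Finset.mul_sum, derivative_X_sub_C_pow] at h
  rw [C_1, Nat.sub_sub] at h
  rw [mul_left_comm, mul_comm _ ((p - 1 : ℕ) : k[X]), ← map_natCast C (p - 1), ← h]
  refine Finset.sum_congr rfl fun i _ => ?_
  rcases i with _ | i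
  · simp
  · simp only [map_natCast, Nat.add_sub_cancel]
    ring

variable {k G : Type} [Field k] [Group G] [Fintype G] {p : ℕ} [hp : Fact p.Prime] [CharP k p]
variable {V W : Type} [AddCommGroup V] [Module k V] [AddCommGroup W] [Module k W]
  {ρ : Representation k G V} {ρW : Representation k G W}

theorem sum_eq_sum_range_pow {M : Type*} [AddCommMonoid M] {t : G}
    (ht : ∀ g, g ∈ Subgroup.zpowers t) (f : G → M) :
    ∑ g, f g = ∑ i ∈ Finset.range (Fintype.card G), f (t ^ i) := by
  classical
  rw [← IsCyclic.image_range_card ht, Finset.sum_image, Nat.card_eq_fintype_card]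
  rw [← orderOf_eq_card_of_forall_mem_zpowers ht]
  simpa using pow_injOn_Iio_orderOf

theorem aeval_sub_one (ρ : Representation k G V) (t : G) (j : ℕ) :
    Polynomial.aeval (ρ t) ((Polynomial.X - 1 : Polynomial k) ^ j) = (ρ t - 1) ^ j := by
  simp

theorem norm_eq_sub_one_pow {t : G} (ht : ∀ g, g ∈ Subgroup.zpowers t)
    (hcard : Fintype.card G = p) (ρ : Representation k G V) : ρ.norm = (ρ t - 1) ^ (p - 1) := by
  rw [Representation.norm, sum_eq_sum_range_pow ht, hcard, ← aeval_sub_one,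
    ← sum_range_X_pow_eq, map_sum]
  simp

theorem sub_one_pow_eq_zero {t : G} (hcard : Fintype.card G = p) (ρ : Representation k G V) :
    (ρ t - 1) ^ p = 0 := by
  rw [← aeval_sub_one, sub_pow_char, one_pow, map_sub, map_pow, Polynomial.aeval_X, ← map_pow,
    ← hcard, pow_card_eq_one]
  simp

theorem equivariant_of_generator {t : G} (ht : ∀ g, g ∈ Subgroup.zpowers t) {f : V →ₗ[k] W}
    (hf : ∀ v, f ((ρ t - 1) v) = (ρW t - 1) (f v)) : Equivariant ρ ρW f := by
  have ht' (v : V) : f (ρ t v) = ρW t (f v) := by simpa using hf v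
  refine .of_apply fun g v => ?_
  obtain ⟨i, rfl⟩ := (mem_powers_iff_mem_zpowers.2 (ht g))
  simp only [map_pow]
  induction i with
  | zero => simp
  | succ i ih => simp [pow_succ', ht', ih]

theorem Equivariant.apply_sub_one_pow {f : V →ₗ[k] W} (hf : Equivariant ρ ρW f) (t : G) (j : ℕ)
    (v : V) : f (((ρ t - 1) ^ j) v) = ((ρW t - 1) ^ j) (f v) := by
  induction j generalizing v with
  | zero => simp
  | succ j ih => simp [pow_succ, ih, hf.apply]

theorem mem_invariants_of_generator {t : G} (ht : ∀ g, g ∈ Subgroup.zpowers t) {v : V}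
    (hv : (ρ t - 1) v = 0) : v ∈ ρ.invariants := by
  intro g
  obtain ⟨i, rfl⟩ := (mem_powers_iff_mem_zpowers.2 (ht g))
  have hv' : ρ t v = v := by simpa [sub_eq_zero] using hv
  simp only [map_pow]
  induction i with
  | zero => simp
  | succ i ih => simp [pow_succ', hv', ih]

/-- If the generator acts trivially up to traces, then elements in the image of `ρ t - 1` that are
invariant are highly divisible. -/
theorem exists_eq_sub_one_pow {t : G} (ht : ∀ g, g ∈ Subgroup.zpowers t)
    (hcard : Fintype.card G = p) (h : StableEq ρ ρ (ρ t) LinearMap.id) {v : V}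
    (hv : (ρ t - 1) ((ρ t - 1) v) = 0) : ∃ w, (ρ t - 1) v = ((ρ t - 1) ^ (p - 2)) w := by
  obtain ⟨f, hf⟩ := isTrace_iff.1 h
  set x := ρ t - 1 with hx
  have hinv := mem_invariants_of_generator ht hv
  have hpow (i : ℕ) : ρ (t ^ i)⁻¹ v = v - (i : k) • x v := by
    rw [Representation.inv_apply_eq_iff, map_sub, map_smul, hinv]
    induction i with
    | zero => simp
    | succ i ih =>
      have h1 : ρ t v = v + x v := by simp [hx]
      rw [pow_succ, map_mul, Module.End.mul_apply, h1, map_add, hinv]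
      nth_rw 1 [ih]
      push_cast
      module
  have h1 : x v = ρ.norm (f v) - ∑ i ∈ Finset.range p, (i : k) • ((ρ t) ^ i) (f (x v)) := by
    have h2 := hf v
    rw [sum_eq_sum_range_pow ht, hcard] at h2
    rw [Representation.norm, LinearMap.sum_apply, sum_eq_sum_range_pow ht, hcard,
      ← Finset.sum_sub_distrib]
    refine (Eq.trans (by simp [hx]) h2).trans (Finset.sum_congr rfl fun i _ => ?_)
    simp [hpow]
  have h2 : ∑ i ∈ Finset.range p, (i : k) • ((ρ t) ^ i) (f (x v)) =
      (x ^ (p - 2)) (ρ t (((p - 1 : ℕ) : k) • f (x v))) := by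
    have h3 := congr_arg (fun q => Polynomial.aeval (ρ t) q (f (x v)))
      (sum_range_mul_X_pow_eq (k := k) p)
    simp only [map_mul, aeval_sub_one] at h3
    simpa [← hx, Nat.cast_smul_eq_nsmul] using h3
  rw [norm_eq_sub_one_pow ht hcard, ← hx, h2] at h1
  rw [h1, show p - 1 = p - 2 + 1 by have := hp.out.two_le; omega, pow_succ, Module.End.mul_apply,
    ← map_sub]
  exact ⟨_, rfl⟩

end Cyclic

section ChainBlock

variable {k V : Type} [Field k] [AddCommGroup V] [Module k V]

/-- A Jordan chain `gen, x gen, …, x ^ len gen` of an endomorphism `x`, together with linear forms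
which behave with respect to `x` like the coordinates of a splitting of the chain. -/
structure ChainBlock (x : Module.End k V) where
  len : ℕ
  gen : V
  coord : ℕ → V →ₗ[k] k
  pow_gen : (x ^ (len + 1)) gen = 0
  coord_zero : ∀ v, coord 0 (x v) = 0
  coord_succ : ∀ j < len, ∀ v, coord (j + 1) (x v) = coord j v
  coord_gen : coord len ((x ^ len) gen) = 1

namespace ChainBlock

variable {x : Module.End k V} (B : ChainBlock x)

/-- The projection onto the span of a chain. -/
def proj : V →ₗ[k] V :=
  ∑ j ∈ Finset.range (B.len + 1), (B.coord j).smulRight ((x ^ j) B.gen)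

theorem proj_apply (v : V) :
    B.proj v = ∑ j ∈ Finset.range (B.len + 1), B.coord j v • (x ^ j) B.gen := by
  simp [proj, LinearMap.sum_apply]

theorem sum_coord_apply {W : Type} [AddCommGroup W] [Module k W] (y : Module.End k W) (w : W)
    (v : V) : ∑ j ∈ Finset.range (B.len + 1), B.coord j (x v) • (y ^ j) w =
      y (∑ j ∈ Finset.range (B.len + 1), B.coord j v • (y ^ j) w) -
        B.coord B.len v • (y ^ (B.len + 1)) w := by
  rw [Finset.sum_range_succ', Finset.sum_range_succ, B.coord_zero, map_add, map_sum, map_smul,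
    pow_succ' y B.len]
  simp only [zero_smul, add_zero, Module.End.mul_apply, add_sub_cancel_right, map_smul]
  refine Finset.sum_congr rfl fun j hj => ?_
  rw [B.coord_succ j (Finset.mem_range.1 hj), pow_succ', Module.End.mul_apply]

theorem proj_comm (v : V) : B.proj (x v) = x (B.proj v) := by
  rw [proj_apply, proj_apply, sum_coord_apply, B.pow_gen, smul_zero, sub_zero]

theorem coord_pow_eq_zero {j l : ℕ} (hjl : j < l) (hj : j ≤ B.len) (v : V) :
    B.coord j ((x ^ l) v) = 0 := by
  induction l generalizing j with
  | zero => omega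
  | succ l ih =>
    rw [pow_succ', Module.End.mul_apply]
    rcases j with _ | j
    · exact B.coord_zero _
    · rw [B.coord_succ j (by omega)]
      exact ih (by omega) (by omega)

theorem le_len_of_eq {l : ℕ} {v : V} (h : (x ^ B.len) B.gen = (x ^ l) v) : l ≤ B.len := by
  by_contra! hl
  have := B.coord_gen
  rw [h, B.coord_pow_eq_zero hl le_rfl] at this
  exact zero_ne_one this

end ChainBlock

theorem exists_chainBlocks {x : Module.End k V} {m : ℕ} (hx : x ^ m = 0) :
    ∃ (ι : Type) (B : ι → ChainBlock x), ∀ v, ∃ S : Finset ι, ∀ S', S ⊆ S' →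
      v = ∑ i ∈ S', (B i).proj v := by
  classical
  obtain ⟨ι, n, a, ha, hli, hspan⟩ := exists_jordan_chains x m ⊤ le_top (by simp [hx])
  let b := Module.Basis.mk hli hspan.ge
  have hb (q : Σ i, Fin (n i + 1)) : (x ^ (q.2 : ℕ)) (a q.1) = b q := by simp [b]
  let c (i : ι) (j : ℕ) : V →ₗ[k] k := if h : j < n i + 1 then b.coord ⟨i, ⟨j, h⟩⟩ else 0
  have hc (i : ι) (j : ℕ) (hj : j < n i + 1) : c i j = b.coord ⟨i, ⟨j, hj⟩⟩ := dif_pos hj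
  have hcb (i : ι) (j : ℕ) (hj : j < n i + 1) (i' : ι) (j' : ℕ) (hj' : j' < n i' + 1) :
      c i j ((x ^ j') (a i')) = if i = i' ∧ j = j' then 1 else 0 := by
    rw [hb ⟨i', ⟨j', hj'⟩⟩, hc i j hj, Module.Basis.coord_apply, Module.Basis.repr_self,
      Finsupp.single_apply]
    refine if_congr ?_ rfl rfl
    constructor
    · intro h
      obtain ⟨rfl, h⟩ := Sigma.mk.inj_iff.1 h
      exact ⟨rfl, by simpa using (eq_of_heq h).symm⟩
    · rintro ⟨rfl, rfl⟩
      rfl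
  let B (i : ι) : ChainBlock x :=
    { len := n i
      gen := a i
      coord := c i
      pow_gen := ha i
      coord_zero := fun v => by
        suffices c i 0 ∘ₗ x = 0 from LinearMap.congr_fun this v
        refine b.ext fun ⟨i', j', hj'⟩ => ?_
        rw [← hb, LinearMap.comp_apply, ← Module.End.mul_apply, ← pow_succ']
        by_cases h : j' + 1 < n i' + 1
        · rw [hcb _ _ (by omega) _ _ h]
          simp
        · obtain rfl : j' = n i' := by omega
          rw [ha]
          simp
      coord_succ := fun j hj v => by
        suffices c i (j + 1) ∘ₗ x = c i j from LinearMap.congr_fun this v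
        refine b.ext fun ⟨i', j', hj'⟩ => ?_
        rw [← hb, LinearMap.comp_apply, ← Module.End.mul_apply, ← pow_succ',
          hcb _ _ (by omega) _ _ hj']
        by_cases h : j' + 1 < n i' + 1
        · rw [hcb _ _ (by omega) _ _ h]
          simp
        · obtain rfl : j' = n i' := by omega
          rw [ha, map_zero, if_neg]
          rintro ⟨rfl, rfl⟩
          omega
      coord_gen := by rw [hcb _ _ (by omega) _ _ (by omega)]; simp }
  refine ⟨ι, B, fun v => ⟨(b.repr v).support.image Sigma.fst, fun S' hS => ?_⟩⟩
  conv_lhs => rw [← b.linearCombination_repr v, Finsupp.linearCombination_apply]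
  rw [Finsupp.sum_of_support_subset (s := S'.sigma fun i => Finset.univ), Finset.sum_sigma]
  · refine Finset.sum_congr rfl fun i _ => ?_
    rw [ChainBlock.proj_apply, Finset.sum_range]
    refine Finset.sum_congr rfl fun j _ => ?_
    rw [← hb]
    exact congr_arg (· • _) (LinearMap.congr_fun (hc i j j.2) v).symm
  · exact fun q hq => Finset.mem_sigma.2
      ⟨hS (Finset.mem_image_of_mem _ hq), Finset.mem_univ _⟩
  · simp

end ChainBlock

namespace ChainBlock

variable {k G : Type} [Field k] [Group G] [Fintype G] {p : ℕ} [hp : Fact p.Prime] [CharP k p]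
variable {V W : Type} [AddCommGroup V] [Module k V] [AddCommGroup W] [Module k W]
  {ρ : Representation k G V} {ρW : Representation k G W} {t : G} (B : ChainBlock (ρ t - 1))

theorem equivariant_proj (ht : ∀ g, g ∈ Subgroup.zpowers t) : Equivariant ρ ρ B.proj :=
  equivariant_of_generator ht B.proj_comm

theorem len_lt (hcard : Fintype.card G = p) : B.len < p := by
  by_contra! h
  have h1 := B.coord_gen
  rw [pow_eq_zero_of_le h (sub_one_pow_eq_zero hcard ρ)] at h1
  simp at h1

theorem len_cases (ht : ∀ g, g ∈ Subgroup.zpowers t) (hcard : Fintype.card G = p)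
    (h : StableEq ρ ρ (ρ t) LinearMap.id) :
    B.len + 1 = p ∨ B.len = 0 ∨ 0 < B.len ∧ B.len + 2 = p := by
  rcases Nat.eq_zero_or_pos B.len with h0 | h0
  · exact .inr (.inl h0)
  have h1 := B.len_lt hcard
  have h2 : (ρ t - 1) ((ρ t - 1) (((ρ t - 1) ^ (B.len - 1)) B.gen)) = 0 := by
    rw [← Module.End.mul_apply, ← Module.End.mul_apply, ← pow_two, ← pow_add,
      show 2 + (B.len - 1) = B.len + 1 by omega, B.pow_gen]
  obtain ⟨w, hw⟩ := exists_eq_sub_one_pow ht hcard h h2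
  rw [← Module.End.mul_apply, ← pow_succ', Nat.sub_add_cancel h0] at hw
  have := B.le_len_of_eq hw
  omega

theorem exists_coefficients (ht : ∀ g, g ∈ Subgroup.zpowers t) (hcard : Fintype.card G = p)
    (hB : p ≤ B.len + 2) :
    ∃ q : V →ₗ[k] (G → k), (∀ v, B.proj v = ∑ g, q v g • ρ g B.gen) ∧
      (∀ s v, ∃ c, ∀ g, q (ρ s v) g = q v (s⁻¹ * g) + c) ∧
      (B.len + 1 = p → ∀ s v g, q (ρ s v) g = q v (s⁻¹ * g)) := by
  classical
  have hp2 := hp.out.two_le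
  have hlt := B.len_lt hcard
  let F := functionRep (Representation.trivial k (G := G) (V := k))
  let δ : G → k := Pi.single 1 1
  let q : V →ₗ[k] (G → k) := ∑ j ∈ Finset.range (B.len + 1),
    (B.coord j).smulRight (((F t - 1) ^ j) δ)
  have hq (v : V) : q v = ∑ j ∈ Finset.range (B.len + 1), B.coord j v • ((F t - 1) ^ j) δ := by
    simp [q, LinearMap.sum_apply]
  have hqx (v : V) : q ((ρ t - 1) v) =
      (F t - 1) (q v) - B.coord B.len v • ((F t - 1) ^ (B.len + 1)) δ := by
    rw [hq, hq, B.sum_coord_apply]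
  let Θ : (G → k) →ₗ[k] V := ∑ g, (LinearMap.proj g).smulRight (ρ g B.gen)
  have hΘ (f : G → k) : Θ f = ∑ g, f g • ρ g B.gen := by simp [Θ, LinearMap.sum_apply]
  have hΘe : Equivariant F ρ Θ := .of_apply fun s f => by
    rw [hΘ, hΘ, map_sum, ← Equiv.sum_comp (Equiv.mulLeft s)]
    simp [F, functionRep_apply]
  have hΘδ : Θ δ = B.gen := by
    rw [hΘ, Finset.sum_eq_single 1] <;> simp +contextual [δ]
  have hF (g h : G) (f : G → k) : F g f h = f (g⁻¹ * h) := rfl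
  have hδ : ∃ c : k, ∀ g, ((F t - 1) ^ (B.len + 1)) δ g = c := by
    rcases (show B.len + 1 = p - 1 ∨ B.len + 1 = p by omega) with h | h
    · refine ⟨1, fun g => ?_⟩
      rw [h, ← norm_eq_sub_one_pow ht hcard, Representation.norm, LinearMap.sum_apply,
        Finset.sum_apply, Finset.sum_eq_single g]
      · simp [hF, δ]
      · intro s _ hs
        exact (hF _ _ _).trans (Pi.single_eq_of_ne (fun h => hs (inv_mul_eq_one.1 h)) _)
      · simp
    · exact ⟨0, fun g => by rw [h, sub_one_pow_eq_zero hcard]; rfl⟩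
  obtain ⟨c, hc⟩ := hδ
  refine ⟨q, fun v => ?_, fun s v => ?_, fun h s v g => ?_⟩
  · rw [← hΘ, hq, map_sum, proj_apply]
    simp only [map_smul, hΘe.apply_sub_one_pow, hΘδ]
  · have h1 (v : V) (g : G) : q (ρ t v) g = q v (t⁻¹ * g) - B.coord B.len v * c := by
      have := congr_fun (hqx v) g
      simp only [Pi.sub_apply, Pi.smul_apply, hc, LinearMap.sub_apply, map_sub, hF,
        Module.End.one_apply, smul_eq_mul] at this
      linear_combination this
    obtain ⟨i, rfl⟩ := mem_powers_iff_mem_zpowers.2 (ht s)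
    simp only [map_pow]
    induction i with
    | zero => exact ⟨0, by simp⟩
    | succ i ih =>
      obtain ⟨d, hd⟩ := ih
      refine ⟨d - B.coord B.len ((ρ t ^ i) v) * c, fun g => ?_⟩
      rw [pow_succ', Module.End.mul_apply, h1, hd]
      simp only [mul_inv_rev, ← mul_assoc, pow_succ']
      ring
  · have hqe : Equivariant ρ F q := equivariant_of_generator ht fun v => by
      rw [hqx, h, sub_one_pow_eq_zero hcard]
      simp
    rw [hqe.apply, hF]

/-- The projection onto a free block is a trace. -/
theorem isTrace_proj (ht : ∀ g, g ∈ Subgroup.zpowers t) (hcard : Fintype.card G = p)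
    (hB : B.len + 1 = p) : IsTrace ρ ρ B.proj := by
  obtain ⟨q, h1, -, h2⟩ := B.exists_coefficients ht hcard (by omega)
  refine isTrace_iff.2 ⟨(LinearMap.proj 1 ∘ₗ q).smulRight B.gen, fun v => ?_⟩
  simp [h1, h2 hB]

theorem norm_gen (ht : ∀ g, g ∈ Subgroup.zpowers t) (hcard : Fintype.card G = p)
    (hB : B.len + 2 = p) : ρ.norm B.gen = 0 := by
  rw [norm_eq_sub_one_pow ht hcard, show p - 1 = B.len + 1 by omega, B.pow_gen]

/-- An equivariant bilinear map is stably skew-symmetric on a block of length `p - 1`. -/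
theorem isTrace_map_proj (ht : ∀ g, g ∈ Subgroup.zpowers t) (hcard : Fintype.card G = p)
    (hB : B.len + 2 = p) {f : V ⊗[k] V →ₗ[k] W} (hf : Equivariant (ρ.tprod ρ) ρW f) :
    IsTrace (ρ.tprod ρ) ρW ((f + f ∘ₗ (TensorProduct.comm k V V).toLinearMap) ∘ₗ
      TensorProduct.map B.proj B.proj) := by
  obtain ⟨q, h1, h2, -⟩ := B.exists_coefficients ht hcard (by omega)
  have hN : ∑ g, ρ g B.gen = 0 := by
    simpa [Representation.norm] using B.norm_gen ht hcard hB
  let d (s : G) : V →ₗ[k] k := LinearMap.proj 1 ∘ₗ q - LinearMap.proj s ∘ₗ q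
  have hd (s g : G) (v : V) : d s (ρ g⁻¹ v) = q v g - q v (g * s) := by
    obtain ⟨c, hc⟩ := h2 g⁻¹ v
    simp [d, hc]
  let H : V ⊗[k] V →ₗ[k] W := ∑ s, TensorProduct.lift
    (((LinearMap.mul k k).compl₁₂ (d s) (d s)).compr₂
      ((LinearMap.id : k →ₗ[k] k).smulRight (f (B.gen ⊗ₜ ρ s B.gen))))
  have hH (v w : V) : H (v ⊗ₜ w) = ∑ s, (d s v * d s w) • f (B.gen ⊗ₜ ρ s B.gen) := by
    simp [H, LinearMap.sum_apply]
  refine ⟨-H, TensorProduct.ext' fun v w => ?_⟩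
  have key : ∑ g, ρW g (H (ρ g⁻¹ v ⊗ₜ ρ g⁻¹ w)) =
      ∑ g, ∑ h, ((q v g - q v h) * (q w g - q w h)) • f (ρ g B.gen ⊗ₜ ρ h B.gen) := by
    refine Finset.sum_congr rfl fun g _ => ?_
    rw [hH, map_sum]
    refine .trans ?_ (Equiv.sum_comp (Equiv.mulLeft g) _)
    refine Finset.sum_congr rfl fun s _ => ?_
    simp [hd, ← hf.apply]
  have hexp (α β : G → k) : f ((∑ g, α g • ρ g B.gen) ⊗ₜ ∑ h, β h • ρ h B.gen) =
      ∑ g, ∑ h, (α g * β h) • f (ρ g B.gen ⊗ₜ ρ h B.gen) := by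
    rw [TensorProduct.sum_tmul, map_sum]
    refine Finset.sum_congr rfl fun g _ => ?_
    simp only [TensorProduct.tmul_sum, map_sum, TensorProduct.smul_tmul_smul, map_smul]
  have hskew : ∑ g, ∑ h, ((q v g - q v h) * (q w g - q w h)) • f (ρ g B.gen ⊗ₜ ρ h B.gen) =
      f ((∑ g, (q v g * q w g) • ρ g B.gen) ⊗ₜ ∑ h, (1 : k) • ρ h B.gen) +
      f ((∑ g, (1 : k) • ρ g B.gen) ⊗ₜ ∑ h, (q v h * q w h) • ρ h B.gen) -
      f (B.proj v ⊗ₜ B.proj w) - f (B.proj w ⊗ₜ B.proj v) := by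
    rw [h1, h1, hexp, hexp, hexp, hexp]
    simp only [← Finset.sum_add_distrib, ← Finset.sum_sub_distrib]
    refine Finset.sum_congr rfl fun g _ => Finset.sum_congr rfl fun h _ => ?_
    module
  simp only [hskew, one_smul, hN, TensorProduct.tmul_zero, TensorProduct.zero_tmul, map_zero,
    zero_add, zero_sub] at key
  simp [LinearMap.sum_apply, key, add_comm]

end ChainBlock

section Decomposition

variable {k G : Type} [Field k] [Group G] [Fintype G]
variable {V W : Type} [AddCommGroup V] [Module k V] [AddCommGroup W] [Module k W]
  {ρ : Representation k G V} {ρ' : Representation k G W} {t : G}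
  {m : V ⊗[k] V →ₗ[k] V} {o : V} {m' : W ⊗[k] W →ₗ[k] W} {o' : W}

namespace IsStableCommRing

theorem isNilpotent_cls_apply (S : IsStableCommRing ρ m o) {Q : V →ₗ[k] V}
    (hQ : Equivariant ρ ρ Q) (h : IsTrace (ρ.tprod ρ) ρ (m ∘ₗ TensorProduct.map Q Q))
    (v : ρ.invariants) : IsNilpotent (S.cls ⟨Q v, hQ.mem_invariants v.2⟩) := by
  refine ⟨2, ?_⟩
  rw [pow_two, S.cls_mul, S.cls_eq_zero_iff]
  exact h.exists_norm (tmul_mem_invariants v.2 v.2)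

theorem isNilpotent_cls_rTensor (S : IsStableCommRing ρ m o) (S' : IsStableCommRing ρ' m' o')
    {Q : V →ₗ[k] V} (hQ : Equivariant ρ ρ Q)
    (h : IsTrace (ρ.tprod ρ) ρ (m ∘ₗ TensorProduct.map Q Q)) (z : (ρ.tprod ρ').invariants) :
    IsNilpotent ((S.tensor S').cls ⟨Q.rTensor W z, hQ.rTensor.mem_invariants z.2⟩) := by
  refine ⟨2, ?_⟩
  rw [pow_two, cls_mul, cls_eq_zero_iff]
  have h1 := (h.map_left S'.equivariant).comp_right
    (equivariant_tensorTensorTensorComm (ρU := ρ) (ρV := ρ') (ρW := ρ) (ρX := ρ'))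
  have h2 : tensorMul m m' ∘ₗ TensorProduct.map (Q.rTensor W) (Q.rTensor W) =
      TensorProduct.map (m ∘ₗ TensorProduct.map Q Q) m' ∘ₗ
        (TensorProduct.tensorTensorTensorComm k V W V W).toLinearMap := by
    ext v w v' w'; rfl
  rw [← h2] at h1
  exact h1.exists_norm (tmul_mem_invariants z.2 z.2)

end IsStableCommRing

variable {p : ℕ} [hp : Fact p.Prime] [CharP k p]

/-- Up to a map whose square is stably trivial, the projection to a block has rank one. -/
theorem ChainBlock.exists_rank_one (S : IsStableCommRing ρ m o)
    (ht : ∀ g, g ∈ Subgroup.zpowers t) (hcard : Fintype.card G = p)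
    (h : StableEq ρ ρ (ρ t) LinearMap.id) (B : ChainBlock (ρ t - 1)) :
    ∃ (l : V →ₗ[k] k) (v : V) (Q : V →ₗ[k] V),
      Equivariant ρ (Representation.trivial k (G := G) (V := k)) l ∧ v ∈ ρ.invariants ∧
      Equivariant ρ ρ Q ∧ B.proj = Q + l.smulRight v ∧
      IsTrace (ρ.tprod ρ) ρ (m ∘ₗ TensorProduct.map Q Q) := by
  have hP := B.equivariant_proj ht
  rcases B.len_cases ht hcard h with h1 | h1 | ⟨h0, h1⟩
  · exact ⟨0, 0, B.proj, .of_apply fun _ _ => by simp, zero_mem _, hP, by simp,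
      ((B.isTrace_proj ht hcard h1).map_left hP).comp_left S.equivariant⟩
  · refine ⟨B.coord 0, B.gen, 0, equivariant_of_generator ht fun v => ?_,
      mem_invariants_of_generator ht ?_, .of_apply fun _ _ => by simp, ?_, ?_⟩
    · rw [B.coord_zero]
      simp
    · simpa [h1] using B.pow_gen
    · simp [ChainBlock.proj, h1]
    · simpa using IsTrace.zero
  · refine ⟨0, 0, B.proj, .of_apply fun _ _ => by simp, zero_mem _, hP, by simp, ?_⟩
    have h2 := (B.isTrace_map_proj ht hcard h1 S.equivariant).add
      ((S.comm.comp_right (hP.map hP))).neg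
    have h3 : (2 : k) ≠ 0 := by
      intro h3
      have := Nat.le_of_dvd two_pos ((CharP.cast_eq_zero_iff k p 2).1 (by exact_mod_cast h3))
      omega
    convert h2.smul (2⁻¹ : k) using 1
    rw [eq_inv_smul_iff₀ h3, LinearMap.add_comp, two_smul]
    abel

theorem exists_finset_eq_sum_rTensor {ι : Type} {P : ι → V →ₗ[k] V}
    (hP : ∀ v, ∃ s : Finset ι, ∀ s', s ⊆ s' → v = ∑ i ∈ s', P i v) (z : V ⊗[k] W) :
    ∃ s : Finset ι, ∀ s', s ⊆ s' → z = ∑ i ∈ s', (P i).rTensor W z := by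
  classical
  induction z with
  | zero => exact ⟨∅, by simp⟩
  | tmul v w =>
    obtain ⟨s, hs⟩ := hP v
    refine ⟨s, fun s' hs' => ?_⟩
    simp only [LinearMap.rTensor_tmul, ← TensorProduct.sum_tmul, ← hs s' hs']
  | add z z' hz hz' =>
    obtain ⟨s, hs⟩ := hz
    obtain ⟨s', hs'⟩ := hz'
    refine ⟨s ∪ s', fun s'' h => ?_⟩
    simp only [map_add, Finset.sum_add_distrib]
    rw [← hs _ (Finset.union_subset_left h), ← hs' _ (Finset.union_subset_right h)]

theorem mem_of_isNilpotent_sub {R : Type} [CommRing R] [Algebra k R] (p : ℕ) [Fact p.Prime]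
    [CharP k p] {D : Subalgebra k R} {x y : R} (hx : IsIdempotentElem x) (hy : y ∈ D)
    (h : IsNilpotent (x - y)) : x ∈ D := by
  nontriviality R
  have := charP_of_injective_algebraMap (algebraMap k R).injective p
  obtain ⟨n, hn⟩ := h
  have h1 : (x - y) ^ p ^ n = 0 :=
    pow_eq_zero_of_le (Nat.lt_pow_self (Fact.out (p := p.Prime)).one_lt).le hn
  rw [sub_pow_char_pow, hx.pow_eq (pow_ne_zero _ (Fact.out (p := p.Prime)).ne_zero),
    sub_eq_zero] at h1
  rw [h1]
  exact pow_mem hy _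

/-- The classes of pure tensors of invariant elements. -/
def pureClasses (S : IsStableCommRing ρ m o) (S' : IsStableCommRing ρ' m' o') :
    Submonoid (S.tensor S').Ring where
  carrier := {x | ∃ (v : ρ.invariants) (w : ρ'.invariants),
    x = (S.tensor S').cls ⟨(v : V) ⊗ₜ (w : W), tmul_mem_invariants v.2 w.2⟩}
  one_mem' := ⟨⟨o, S.one_mem⟩, ⟨o', S'.one_mem⟩, rfl⟩
  mul_mem' := by
    rintro _ _ ⟨v, w, rfl⟩ ⟨v', w', rfl⟩
    exact ⟨S.invMul v v', S'.invMul w w', rfl⟩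

theorem isIdempotent_cls_mem (S : IsStableCommRing ρ m o) (S' : IsStableCommRing ρ' m' o')
    (ht : ∀ g, g ∈ Subgroup.zpowers t) (hcard : Fintype.card G = p)
    (h : StableEq ρ ρ (ρ t) LinearMap.id) (z : (ρ.tprod ρ').invariants)
    (hz : IsIdempotentElem ((S.tensor S').cls z)) :
    (S.tensor S').cls z ∈ Submodule.span k (pureClasses S S' : Set (S.tensor S').Ring) := by
  obtain ⟨ι, B, hB⟩ := exists_chainBlocks (sub_one_pow_eq_zero hcard ρ)
  obtain ⟨s, hs⟩ := exists_finset_eq_sum_rTensor hB (z : V ⊗[k] W)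
  choose l v Q hl hv hQ hlQ hQtr using fun i => (B i).exists_rank_one S ht hcard h
  let w (i : ι) : W := TensorProduct.lid k W ((l i).rTensor W z)
  have hlid : Equivariant ((Representation.trivial k (G := G) (V := k)).tprod ρ') ρ'
      (TensorProduct.lid k W).toLinearMap := fun g => by ext; simp
  have hw (i : ι) : w i ∈ ρ'.invariants := (hlid.comp (hl i).rTensor).mem_invariants z.2
  have hlw (i : ι) : ((l i).smulRight (v i)).rTensor W z = v i ⊗ₜ w i := by
    suffices ((l i).smulRight (v i)).rTensor W = TensorProduct.mk k V W (v i) ∘ₗ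
        (TensorProduct.lid k W).toLinearMap ∘ₗ (l i).rTensor W from LinearMap.congr_fun this _
    ext
    simp [TensorProduct.smul_tmul']
  have hzsum : z = ∑ i ∈ s, (⟨(Q i).rTensor W z, (hQ i).rTensor.mem_invariants z.2⟩ +
      ⟨v i ⊗ₜ w i, tmul_mem_invariants (hv i) (hw i)⟩ : (ρ.tprod ρ').invariants) := by
    refine Subtype.ext ((hs s subset_rfl).trans ?_)
    simp [hlQ, LinearMap.rTensor_add, hlw]
  let D := Algebra.adjoin k (pureClasses S S' : Set (S.tensor S').Ring)
  have hD : (S.tensor S').cls z ∈ D := by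
    refine mem_of_isNilpotent_sub p hz (y := ∑ i ∈ s, (S.tensor S').cls
      ⟨v i ⊗ₜ w i, tmul_mem_invariants (hv i) (hw i)⟩) (sum_mem fun i _ => ?_) ?_
    · exact Algebra.subset_adjoin ⟨⟨v i, hv i⟩, ⟨w i, hw i⟩, rfl⟩
    · have h2 := congr_arg (S.tensor S').cls hzsum
      simp only [map_sum, map_add, Finset.sum_add_distrib] at h2
      rw [sub_eq_iff_eq_add.2 h2]
      exact isNilpotent_sum fun i _ => S.isNilpotent_cls_rTensor S' (hQ i) (hQtr i) z
  rw [← Subalgebra.mem_toSubmodule, Algebra.adjoin_eq_span, Submonoid.closure_eq] at hD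
  exact hD

theorem IsSeparabilityElement.congr {e e' : V ⊗[k] V} (H : IsSeparabilityElement ρ m e)
    (S : IsStableCommRing ρ m o) {w : V ⊗[k] V} (h : e' = e + (ρ.tprod ρ).norm w) :
    IsSeparabilityElement ρ m e' := by
  have hl : StableEq ρ (ρ.tprod ρ) (leftAct m e') (leftAct m e) := by
    rw [StableEq, h, leftAct_add, add_sub_cancel_left]
    exact ((IsTrace.mk_flip_norm w).comp_left equivariant_assoc_symm).comp_left
      S.equivariant.rTensor
  have hr : StableEq ρ (ρ.tprod ρ) (rightAct m e') (rightAct m e) := by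
    rw [StableEq, h, rightAct_add, add_sub_cancel_left]
    exact ((IsTrace.mk_norm w).comp_left equivariant_assoc).comp_left S.equivariant.lTensor
  exact ⟨h ▸ add_mem H.mem (Representation.norm_mem_invariants _ _),
    hl.trans (H.slide.trans hr.symm), (hl.comp_left S.equivariant).trans H.mul_leftAct⟩

/-- A separability element can be chosen to be a sum of tensors of invariant elements. -/
theorem IsSeparabilityElement.exists_eq_sum {e : V ⊗[k] V} (H : IsSeparabilityElement ρ m e)
    (S : IsStableCommRing ρ m o) (ht : ∀ g, g ∈ Subgroup.zpowers t)
    (hcard : Fintype.card G = p) (h : StableEq ρ ρ (ρ t) LinearMap.id) :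
    ∃ s : Finset (ρ.invariants × ρ.invariants),
      IsSeparabilityElement ρ m (∑ i ∈ s, (i.1 : V) ⊗ₜ (i.2 : V)) := by
  have h1 := isIdempotent_cls_mem S S ht hcard h ⟨e, H.mem⟩
    (((S.tensor S).cls_eq_iff _ _).2 (H.isIdempotent S))
  obtain ⟨s, hs⟩ : ∃ s : Finset (ρ.invariants × ρ.invariants), (S.tensor S).cls ⟨e, H.mem⟩ =
      ∑ i ∈ s, (S.tensor S).cls ⟨(i.1 : V) ⊗ₜ (i.2 : V), tmul_mem_invariants i.1.2 i.2.2⟩ := by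
    let J : ρ.invariants ⊗[k] ρ.invariants →ₗ[k] (S.tensor S).Ring :=
      TensorProduct.lift (LinearMap.mk₂ k (fun v w => (S.tensor S).cls
          ⟨(v : V) ⊗ₜ (w : V), tmul_mem_invariants v.2 w.2⟩)
        (fun _ _ _ => by
          rw [← map_add]; exact congr_arg _ (Subtype.ext (by simp [TensorProduct.add_tmul])))
        (fun _ _ _ => by
          rw [← map_smul]; exact congr_arg _ (Subtype.ext (by simp [TensorProduct.smul_tmul'])))
        (fun _ _ _ => by
          rw [← map_add]; exact congr_arg _ (Subtype.ext (by simp [TensorProduct.tmul_add])))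
        (fun _ _ _ => by rw [← map_smul]; exact congr_arg _ (Subtype.ext (by simp))))
    have h2 : Submodule.span k (pureClasses S S : Set (S.tensor S).Ring) ≤ LinearMap.range J := by
      rw [Submodule.span_le]
      rintro _ ⟨v, w, rfl⟩
      exact ⟨v ⊗ₜ w, rfl⟩
    obtain ⟨d, hd⟩ := h2 h1
    obtain ⟨s, rfl⟩ := TensorProduct.exists_finset d
    refine ⟨s, ?_⟩
    rw [← hd, map_sum]
    rfl
  rw [← map_sum, eq_comm, IsStableCommRing.cls_eq_iff] at hs
  obtain ⟨w, hw⟩ := hs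
  refine ⟨s, H.congr S (w := w) ?_⟩
  simpa using hw

end Decomposition

section FiniteModel

variable {k G : Type} [Field k] [Group G] [Fintype G]
variable {U V W : Type} [AddCommGroup U] [Module k U] [AddCommGroup V] [Module k V]
  [AddCommGroup W] [Module k W]
  {ρU : Representation k G U} {ρV : Representation k G V} {ρW : Representation k G W}

/-- A linear map is stably equal to a map of finite rank which factors through the coinvariants
of the source and the invariants of the target. -/
def HasFiniteModel (ρV : Representation k G V) (ρW : Representation k G W) (f : V →ₗ[k] W) :
    Prop :=
  ∃ f', StableEq ρV ρW f f' ∧ (∀ g v, f' (ρV g v) = f' v) ∧ (∀ v, f' v ∈ ρW.invariants) ∧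
    FiniteDimensional k (LinearMap.range f')

namespace HasFiniteModel

theorem congr {f f' : V →ₗ[k] W} (h : HasFiniteModel ρV ρW f) (h' : StableEq ρV ρW f' f) :
    HasFiniteModel ρV ρW f' := by
  obtain ⟨a, ha, h⟩ := h
  exact ⟨a, h'.trans ha, h⟩

theorem zero : HasFiniteModel ρV ρW 0 :=
  ⟨0, .refl _, by simp, fun _ => zero_mem _, by rw [LinearMap.range_zero]; infer_instance⟩

theorem add {f f' : V →ₗ[k] W} (h : HasFiniteModel ρV ρW f) (h' : HasFiniteModel ρV ρW f') :
    HasFiniteModel ρV ρW (f + f') := by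
  obtain ⟨a, h1, h2, h3, h4⟩ := h
  obtain ⟨a', h1', h2', h3', h4'⟩ := h'
  refine ⟨a + a', h1.add h1', by simp [h2, h2'], fun v => add_mem (h3 v) (h3' v), ?_⟩
  exact Submodule.finiteDimensional_of_le (LinearMap.range_add_le a a')

theorem sum {ι : Type*} {s : Finset ι} {f : ι → V →ₗ[k] W}
    (hf : ∀ i ∈ s, HasFiniteModel ρV ρW (f i)) : HasFiniteModel ρV ρW (∑ i ∈ s, f i) :=
  Finset.sum_induction _ _ (fun _ _ => add) zero hf

theorem comp_right {f : V →ₗ[k] W} (h : HasFiniteModel ρV ρW f) {e : U →ₗ[k] V}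
    (he : Equivariant ρU ρV e) : HasFiniteModel ρU ρW (f ∘ₗ e) := by
  obtain ⟨a, h1, h2, h3, h4⟩ := h
  refine ⟨a ∘ₗ e, h1.comp_right he, by simp [he.apply, h2], fun v => h3 _, ?_⟩
  exact Submodule.finiteDimensional_of_le (LinearMap.range_comp_le_range e a)

theorem smulRight {l : V →ₗ[k] k}
    (hl : Equivariant ρV (Representation.trivial k (G := G) (V := k)) l) {w : W}
    (hw : w ∈ ρW.invariants) : HasFiniteModel ρV ρW (l.smulRight w) := by
  refine ⟨_, .refl _, by simp [hl.apply], fun v => ρW.invariants.smul_mem _ hw, ?_⟩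
  refine Submodule.finiteDimensional_of_le (S₂ := Submodule.span k {w}) ?_
  rintro _ ⟨v, rfl⟩
  exact Submodule.smul_mem _ _ (Submodule.mem_span_singleton_self w)

end HasFiniteModel

variable {ρ : Representation k G V} {m : V ⊗[k] V →ₗ[k] V} {o : V}

/-- The ideal of classes of elements acting through a finite-dimensional trivial module. -/
noncomputable def IsStableCommRing.finiteIdeal (S : IsStableCommRing ρ m o) : Ideal S.Ring where
  carrier := {x | ∃ r : ρ.invariants, S.cls r = x ∧
    HasFiniteModel ρ ρ (m ∘ₗ TensorProduct.mk k V V r)}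
  zero_mem' := ⟨0, by simp, by simpa using HasFiniteModel.zero⟩
  add_mem' := by
    rintro _ _ ⟨r, rfl, hr⟩ ⟨r', rfl, hr'⟩
    exact ⟨r + r', by simp, by simpa [LinearMap.comp_add] using hr.add hr'⟩
  smul_mem' := by
    rintro c _ ⟨r, rfl, hr⟩
    obtain ⟨w, rfl⟩ := S.cls_surjective c
    refine ⟨S.invMul r w, by rw [← S.cls_mul, smul_eq_mul, mul_comm], ?_⟩
    refine (hr.comp_right (S.equivariant.comp (equivariant_mk w.2))).congr ?_
    exact S.assoc.comp_right (equivariant_mk (tmul_mem_invariants r.2 w.2))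

theorem leftAct_sum {ι : Type} (s : Finset ι) (m : V ⊗[k] V →ₗ[k] V) (e : ι → V ⊗[k] V) :
    leftAct m (∑ i ∈ s, e i) = ∑ i ∈ s, leftAct m (e i) :=
  map_sum (AddMonoidHom.mk' (leftAct m) (leftAct_add m)) e s

theorem rightAct_sum {ι : Type} (s : Finset ι) (m : V ⊗[k] V →ₗ[k] V) (e : ι → V ⊗[k] V) :
    rightAct m (∑ i ∈ s, e i) = ∑ i ∈ s, rightAct m (e i) :=
  map_sum (AddMonoidHom.mk' (rightAct m) (rightAct_add m)) e s

namespace IsSeparabilityElement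

variable {s : Finset (ρ.invariants × ρ.invariants)}

theorem cls_sum_mem (H : IsSeparabilityElement ρ m (∑ i ∈ s, (i.1 : V) ⊗ₜ (i.2 : V)))
    (S : IsStableCommRing ρ m o) {l : V →ₗ[k] k}
    (hl : Equivariant ρ (Representation.trivial k (G := G) (V := k)) l) :
    S.cls (∑ i ∈ s, l i.1 • i.2) ∈ S.finiteIdeal := by
  refine ⟨_, rfl, ?_⟩
  have hlid : Equivariant ((Representation.trivial k (G := G) (V := k)).tprod ρ) ρ
      (TensorProduct.lid k V).toLinearMap := fun g => by ext; simp
  have h1 : StableEq ρ ρ (m ∘ₗ TensorProduct.mk k V V (∑ i ∈ s, l i.1 • i.2 : ρ.invariants))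
      (∑ i ∈ s, (l ∘ₗ m ∘ₗ (TensorProduct.mk k V V).flip i.1).smulRight (i.2 : V)) := by
    convert (H.slide.comp_left (hlid.comp hl.rTensor)).symm using 1
    · ext a
      simp [rightAct_sum, rightAct_tmul]
    · ext a
      simp [leftAct_sum, LinearMap.sum_apply, leftAct_tmul]
  exact (HasFiniteModel.sum fun i _ => .smulRight
    (hl.comp (S.equivariant.comp (equivariant_mk_flip i.1.2))) i.2.2).congr h1

theorem sum_cls_mul_cls (H : IsSeparabilityElement ρ m (∑ i ∈ s, (i.1 : V) ⊗ₜ (i.2 : V)))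
    (S : IsStableCommRing ρ m o) : ∑ i ∈ s, S.cls i.1 * S.cls i.2 = 1 := by
  simp only [S.cls_mul, ← map_sum, ← S.cls_one]
  refine (S.cls_eq_iff _ _).2 ?_
  simpa using H.mul_eq_one S

variable {p : ℕ} [hp : Fact p.Prime] [CharP k p] {t : G}

theorem hasFiniteModel_id (H : IsSeparabilityElement ρ m (∑ i ∈ s, (i.1 : V) ⊗ₜ (i.2 : V)))
    (S : IsStableCommRing ρ m o) (ht : ∀ g, g ∈ Subgroup.zpowers t)
    (hcard : Fintype.card G = p) (h : StableEq ρ ρ (ρ t) LinearMap.id) :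
    HasFiniteModel ρ ρ LinearMap.id := by
  obtain ⟨ι, B, hB⟩ := exists_chainBlocks (sub_one_pow_eq_zero hcard ρ)
  obtain ⟨b, hb⟩ := exists_finset_eq_sum_rTensor hB (∑ i ∈ s, (i.1 : V) ⊗ₜ[k] (i.2 : V))
  choose l v Q hl hv hQ hlQ hQtr using fun i => (B i).exists_rank_one S ht hcard h
  have h1 : ∑ i ∈ s, S.invMul i.1 i.2 = ∑ j ∈ b, (S.invMul ⟨v j, hv j⟩ (∑ i ∈ s, l j i.1 • i.2) +
      ∑ i ∈ s, S.invMul ⟨Q j i.1, (hQ j).mem_invariants i.1.2⟩ i.2) := by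
    refine Subtype.ext ?_
    have := congr_arg m (hb b subset_rfl)
    simp only [map_sum, LinearMap.rTensor_tmul, hlQ, LinearMap.add_apply,
      LinearMap.smulRight_apply, TensorProduct.add_tmul, map_add,
      ← TensorProduct.smul_tmul', map_smul] at this
    simp only [AddSubmonoidClass.coe_finsetSum, Submodule.coe_add, IsStableCommRing.coe_invMul,
      this, Finset.sum_add_distrib, map_sum, Submodule.coe_smul, map_smul]
    rw [add_comm]
  have h2 : 1 - ∑ j ∈ b, S.cls ⟨v j, hv j⟩ * S.cls (∑ i ∈ s, l j i.1 • i.2) =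
      ∑ j ∈ b, ∑ i ∈ s, S.cls ⟨Q j i.1, (hQ j).mem_invariants i.1.2⟩ * S.cls i.2 := by
    rw [sub_eq_iff_eq_add', ← H.sum_cls_mul_cls S, ← Finset.sum_add_distrib]
    have h := congr_arg S.cls h1
    simp only [map_sum S.cls, map_add S.cls] at h
    simp only [S.cls_mul]
    exact h
  have h3 : IsNilpotent (1 - ∑ j ∈ b, S.cls ⟨v j, hv j⟩ * S.cls (∑ i ∈ s, l j i.1 • i.2)) := by
    rw [h2]
    exact isNilpotent_sum fun j _ => isNilpotent_sum fun i _ =>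
      (Commute.all _ _).isNilpotent_mul_right (S.isNilpotent_cls_apply (hQ j) (hQtr j) i.1)
  have h4 : S.finiteIdeal = ⊤ := by
    have hmem : ∑ j ∈ b, S.cls ⟨v j, hv j⟩ * S.cls (∑ i ∈ s, l j i.1 • i.2) ∈ S.finiteIdeal :=
      sum_mem fun j _ => Ideal.mul_mem_left _ _ (H.cls_sum_mem S (hl j))
    exact Ideal.eq_top_of_isUnit_mem _ hmem (by simpa using h3.isUnit_one_sub)
  obtain ⟨r, hr, hfin⟩ : (1 : S.Ring) ∈ S.finiteIdeal := h4 ▸ Submodule.mem_top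
  rw [← S.cls_one, S.cls_eq_iff] at hr
  obtain ⟨u, hu⟩ := hr
  refine hfin.congr (S.one_mul.symm.trans ?_)
  rw [StableEq, hu, map_add, LinearMap.comp_add, sub_add_cancel_left]
  exact ((IsTrace.mk_norm u).comp_left S.equivariant).neg

end IsSeparabilityElement

end FiniteModel

section Retract

variable {k G : Type} [Field k] [Group G] [Fintype G]
variable {V W : Type} [AddCommGroup V] [Module k V] [AddCommGroup W] [Module k W]
  {ρ : Representation k G V} {ρW : Representation k G W}

theorem Representation.norm_trivial_eq_zero {p : ℕ} [CharP k p] (hcard : Fintype.card G = p) :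
    (Representation.trivial k (G := G) (V := W)).norm = 0 := by
  ext w
  simp [Representation.norm, hcard, ← Nat.cast_smul_eq_nsmul k]

variable {m : V ⊗[k] V →ₗ[k] V} {o : V}

/-- A homomorphism, up to stable equality, from a stable ring to a ring with trivial action. -/
structure IsRetraction (S : IsStableCommRing ρ m o) (π : V →ₗ[k] S.Ring) (ψ : S.Ring →ₗ[k] V) :
    Prop where
  apply_rho : ∀ g v, π (ρ g v) = π v
  apply_coe : ∀ v : ρ.invariants, π v = S.cls v
  mem_invariants : ∀ x, ψ x ∈ ρ.invariants
  cls_apply : ∀ x, S.cls ⟨ψ x, mem_invariants x⟩ = x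
  stableEq : StableEq ρ ρ (ψ ∘ₗ π) LinearMap.id

namespace IsRetraction

variable {S : IsStableCommRing ρ m o} {π : V →ₗ[k] S.Ring} {ψ : S.Ring →ₗ[k] V}

theorem equivariant_left (R : IsRetraction S π ψ) :
    Equivariant ρ (Representation.trivial k (G := G) (V := S.Ring)) π :=
  .of_apply R.apply_rho

theorem equivariant_right (R : IsRetraction S π ψ) :
    Equivariant (Representation.trivial k (G := G) (V := S.Ring)) ρ ψ :=
  .of_apply fun g x => (R.mem_invariants x g).symm

theorem comp_eq_id (R : IsRetraction S π ψ) : π ∘ₗ ψ = LinearMap.id :=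
  LinearMap.ext fun x => (R.apply_coe ⟨ψ x, R.mem_invariants x⟩).trans (R.cls_apply x)

theorem apply_mul (R : IsRetraction S π ψ) {v w : V} (hv : v ∈ ρ.invariants)
    (hw : w ∈ ρ.invariants) : π (m (v ⊗ₜ w)) = π v * π w := by
  rw [R.apply_coe ⟨v, hv⟩, R.apply_coe ⟨w, hw⟩, S.cls_mul, ← R.apply_coe, S.coe_invMul]

theorem apply_one (R : IsRetraction S π ψ) : π o = 1 :=
  R.apply_coe ⟨o, S.one_mem⟩

theorem stableEq_mul (R : IsRetraction S π ψ) :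
    StableEq (ρ.tprod ρ) (Representation.trivial k (G := G) (V := S.Ring)) (π ∘ₗ m)
      (LinearMap.mul' k S.Ring ∘ₗ TensorProduct.map π π) := by
  have h := (R.stableEq.map R.stableEq .id
    (R.equivariant_right.comp R.equivariant_left)).comp_left
    (R.equivariant_left.comp S.equivariant)
  refine StableEq.symm ?_
  convert h using 1
  · ext v w
    have h1 (x) : π (ψ x) = x := LinearMap.congr_fun R.comp_eq_id x
    simp [R.apply_mul (R.mem_invariants _) (R.mem_invariants _), h1]
  · rw [TensorProduct.map_id, LinearMap.comp_id]

end IsRetraction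

theorem HasFiniteModel.exists_isRetraction (h : HasFiniteModel ρ ρ LinearMap.id)
    (S : IsStableCommRing ρ m o) :
    ∃ π ψ, IsRetraction S π ψ ∧ FiniteDimensional k S.Ring := by
  obtain ⟨f, hf, hρ, hinv, hfin⟩ := h
  obtain ⟨s, hs⟩ := S.cls.exists_rightInverse_of_surjective
    (LinearMap.range_eq_top.2 S.cls_surjective)
  have hs' (x) : S.cls (s x) = x := LinearMap.congr_fun hs x
  have hcls (v : ρ.invariants) : S.cls (f.codRestrict _ hinv v) = S.cls v :=
    ((S.cls_eq_iff _ _).2 (hf.exists_norm v.2)).symm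
  refine ⟨S.cls ∘ₗ f.codRestrict _ hinv, ρ.invariants.subtype ∘ₗ s,
    ⟨fun g v => congr_arg S.cls (Subtype.ext (hρ g v)), hcls, fun x => (s x).2, hs',
      StableEq.trans ?_ hf.symm⟩, ?_⟩
  · refine IsTrace.of_forall_mem_range_norm (fun g v => ?_) fun v => ?_
    · have h1 : f.codRestrict _ hinv (ρ g v) = f.codRestrict _ hinv v := Subtype.ext (hρ g v)
      simp [h1, hρ]
    · obtain ⟨u, hu⟩ := (S.cls_eq_iff _ _).1 (hs' (S.cls (f.codRestrict _ hinv v)))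
      exact ⟨u, by simp [hu]⟩
  · refine Module.Finite.of_surjective (S.cls ∘ₗ Submodule.inclusion
      (p := LinearMap.range f) (by rintro _ ⟨v, rfl⟩; exact hinv v)) fun x => ?_
    obtain ⟨v, rfl⟩ := S.cls_surjective x
    exact ⟨⟨f v, v, rfl⟩, hcls v⟩

theorem IsSeparabilityElement.formallyUnramified {p : ℕ} [CharP k p]
    (hcard : Fintype.card G = p) {s : Finset (ρ.invariants × ρ.invariants)}
    (H : IsSeparabilityElement ρ m (∑ i ∈ s, (i.1 : V) ⊗ₜ (i.2 : V)))
    {S : IsStableCommRing ρ m o} [FiniteDimensional k S.Ring]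
    {π : V →ₗ[k] S.Ring} {ψ : S.Ring →ₗ[k] V} (R : IsRetraction S π ψ) :
    Algebra.FormallyUnramified k S.Ring := by
  refine Algebra.FormallyUnramified.iff_exists_tensorProduct.2
    ⟨∑ i ∈ s, S.cls i.1 ⊗ₜ S.cls i.2, fun x => ?_, by simpa using H.sum_cls_mul_cls S⟩
  obtain ⟨a, rfl⟩ := S.cls_surjective x
  obtain ⟨u, hu⟩ := (H.slide.comp_left (R.equivariant_left.map R.equivariant_left)).exists_norm a.2
  have htriv : (Representation.trivial k (G := G) (V := S.Ring)).tprod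
      (Representation.trivial k (G := G) (V := S.Ring)) =
      Representation.trivial k (G := G) (V := S.Ring ⊗[k] S.Ring) := by
    ext g x y; simp
  rw [htriv, Representation.norm_trivial_eq_zero hcard, LinearMap.zero_apply, add_zero] at hu
  simp only [leftAct_sum, rightAct_sum, LinearMap.comp_apply, LinearMap.sum_apply, map_sum,
    leftAct_tmul, rightAct_tmul, TensorProduct.map_tmul, R.apply_mul a.2 (Subtype.prop _),
    R.apply_mul (Subtype.prop _) a.2, R.apply_coe] at hu
  rw [sub_mul, sub_eq_zero, Finset.mul_sum, Finset.mul_sum]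
  simp only [Algebra.TensorProduct.tmul_mul_tmul, one_mul, mul_comm (S.cls a)]
  rw [← hu]
  simp only [mul_comm (S.cls a)]

end Retract

theorem exists_algEquiv_pi_fin (k R : Type) [Field k] [CommRing R] [Algebra k R]
    [FiniteDimensional k R] [Algebra.FormallyUnramified k R] :
    ∃ (n : ℕ) (L : Fin n → Type) (_ : ∀ i, Field (L i)) (_ : ∀ i, Algebra k (L i))
      (_ : R ≃ₐ[k] ∀ i, L i),
      (∀ i, FiniteDimensional k (L i)) ∧ ∀ i, Algebra.IsSeparable k (L i) := by
  have := Algebra.FormallyEtale.of_formallyUnramified_of_field k R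
  obtain ⟨I, hI, L, hF, hA, e, hsep⟩ := (Algebra.FormallyEtale.iff_exists_algEquiv_prod k R).1 this
  obtain ⟨n, ⟨b⟩⟩ := Finite.exists_equiv_fin I
  refine ⟨n, fun i => L (b.symm i), fun i => hF _, fun i => hA _,
    e.trans (AlgEquiv.piCongrLeft' k L b), fun i => ?_, fun i => hsep _⟩
  exact Module.Finite.of_surjective ((Pi.evalAlgHom k L (b.symm i)).comp e.toAlgHom).toLinearMap
    ((Function.surjective_eval _).comp e.surjective)

/-- Over a cyclic group of prime order `p = char k`, every stable tt-ring in the (big)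
stable module category is stably isomorphic, as a ring, to a finite product
`L₁ × ⋯ × Lₙ` of finite separable field extensions of `k`, with trivial `G`-action. -/
theorem stable_tt_ring_over_C_p_is_product_of_separable_extensions
    (p : ℕ) (hp : p.Prime)
    (k : Type) [Field k] [CharP k p]
    (G : Type) [Group G] [Fintype G] (hcyc : IsCyclic G) (hcard : Fintype.card G = p)
    (A : Type) [AddCommGroup A] [Module k A]
    (ρ : Representation k G A) (T : StableTTRing ρ) :
    ∃ (n : ℕ) (L : Fin n → Type) (_ : ∀ i, Field (L i)) (_ : ∀ i, Algebra k (L i)),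
      (∀ i, FiniteDimensional k (L i)) ∧ (∀ i, Algebra.IsSeparable k (L i)) ∧
      ∃ φ : A →ₗ[k] (∀ i, L i),
        StableIso ρ (Representation.trivial k (G := G) (V := ∀ i, L i)) φ ∧
        StablyTrivial (ρ.tprod ρ) (Representation.trivial k (G := G) (V := ∀ i, L i))
          (φ ∘ₗ T.mul - LinearMap.mul' k (∀ i, L i) ∘ₗ TensorProduct.map φ φ) ∧
        StablyTrivial (Representation.trivial k (G := G) (V := k))
          (Representation.trivial k (G := G) (V := ∀ i, L i))
          (φ ∘ₗ T.one - Algebra.linearMap k (∀ i, L i)) := by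
  have : Fact p.Prime := ⟨hp⟩
  obtain ⟨t, ht⟩ := hcyc.exists_generator
  have S := T.isStableCommRing
  have hid := T.isSeparabilityElement.stableEq_id S (fun a b => hcyc.commGroup.mul_comm a b) hcard t
  obtain ⟨s, H⟩ := T.isSeparabilityElement.exists_eq_sum S ht hcard hid
  obtain ⟨π, ψ, R, hfin⟩ := (H.hasFiniteModel_id S ht hcard hid).exists_isRetraction S
  have := H.formallyUnramified hcard R
  obtain ⟨n, L, hF, hA, e, hL, hsep⟩ := exists_algEquiv_pi_fin k S.Ring
  have he : Equivariant (Representation.trivial k (G := G) (V := S.Ring))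
      (Representation.trivial k (G := G) (V := ∀ i, L i)) e.toLinearMap := fun _ => rfl
  have he' : Equivariant (Representation.trivial k (G := G) (V := ∀ i, L i))
      (Representation.trivial k (G := G) (V := S.Ring)) e.symm.toLinearMap := fun _ => rfl
  simp only [StableIso, stablyTrivial_iff_isTrace]
  refine ⟨n, L, hF, hA, hL, hsep, e.toLinearMap ∘ₗ π, ⟨he.comp R.equivariant_left,
    ψ ∘ₗ e.symm.toLinearMap, R.equivariant_right.comp he', ?_, ?_⟩, ?_, ?_⟩
  · exact StableEq.trans (.of_eq (by ext a; simp)) R.stableEq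
  · refine StableEq.of_eq (LinearMap.ext fun x => ?_)
    have h1 (x) : π (ψ x) = x := LinearMap.congr_fun R.comp_eq_id x
    simp [h1]
  · exact StableEq.trans (R.stableEq_mul.comp_left he) (.of_eq (by ext a b; simp))
  · refine StableEq.of_eq (LinearMap.ext_ring ?_)
    simp [R.apply_one]
end

section
/- Let (C, ⊗, 1) be a preadditive monoidal category and let (A, μ, u) be a monoid object in C that is separable, i.e., there exists a morphism σ: A → A⊗A with μ∘σ = id_A and (μ⊗id_A)∘(id_A⊗σ) = σ∘μ = (id_A⊗μ)∘(σ⊗id_A). Let (M', ρ') and (M, ρ) be left A-module objects in C and let f: M' → M be an A-linear morphism whose underlying morphism in C admits a retraction (some r: M → M' in C with r∘f = id_{M'}). Then f admits an A-linear retraction, i.e., there exists a morphism r̄: M → M' of A-module objects with r̄∘f = id_{M'}. -/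
open CategoryTheory MonoidalCategory

/-- Relative semisimplicity: if `(A, μ, u)` is a separable monoid object in a
preadditive monoidal category `C`, `(M', ρ')` and `(M, ρ)` are left `A`-module
objects, and `f : M' ⟶ M` is `A`-linear and admits a retraction in `C`, then `f`
admits an `A`-linear retraction. -/
theorem separable_monoid_module_retraction
    {C : Type*} [Category C] [Preadditive C] [MonoidalCategory C] [MonoidalPreadditive C]
    (A : C) (μ : A ⊗ A ⟶ A) (u : 𝟙_ C ⟶ A)
    (hassoc : (μ ▷ A) ≫ μ = (α_ A A A).hom ≫ (A ◁ μ) ≫ μ)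
    (hone_mul : (u ▷ A) ≫ μ = (λ_ A).hom)
    (hmul_one : (A ◁ u) ≫ μ = (ρ_ A).hom)
    (σ : A ⟶ A ⊗ A) (hsep : σ ≫ μ = 𝟙 A)
    (hsec_left : (A ◁ σ) ≫ (α_ A A A).inv ≫ (μ ▷ A) = μ ≫ σ)
    (hsec_right : (σ ▷ A) ≫ (α_ A A A).hom ≫ (A ◁ μ) = μ ≫ σ)
    (M' M : C) (act' : A ⊗ M' ⟶ M') (act : A ⊗ M ⟶ M)
    (hact'_assoc : (μ ▷ M') ≫ act' = (α_ A A M').hom ≫ (A ◁ act') ≫ act')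
    (hact'_one : (u ▷ M') ≫ act' = (λ_ M').hom)
    (hact_assoc : (μ ▷ M) ≫ act = (α_ A A M).hom ≫ (A ◁ act) ≫ act)
    (hact_one : (u ▷ M) ≫ act = (λ_ M).hom)
    (f : M' ⟶ M) (hf : act' ≫ f = (A ◁ f) ≫ act)
    (r : M ⟶ M') (hr : f ≫ r = 𝟙 M') :
    ∃ rbar : M ⟶ M', (act ≫ rbar = (A ◁ rbar) ≫ act') ∧ f ≫ rbar = 𝟙 M' := by
  set T : (A ⊗ A) ⊗ M ⟶ M' := (α_ A A M).hom ≫ A ◁ (act ≫ r) ≫ act' with hT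
  have T_left : A ◁ T ≫ act' =
      (α_ A (A ⊗ A) M).inv ≫ ((α_ A A A).inv ≫ μ ▷ A) ▷ M ≫ T := by
    have h : μ ▷ (A ⊗ M) ≫ A ◁ (act ≫ r) ≫ act' =
        (α_ A A (A ⊗ M)).hom ≫ A ◁ (A ◁ (act ≫ r) ≫ act') ≫ act' := by
      rw [← whisker_exchange_assoc, hact'_assoc]
      simp
    have h' : (μ ▷ A) ▷ M ≫ T =
        (α_ (A ⊗ A) A M).hom ≫ μ ▷ (A ⊗ M) ≫ A ◁ (act ≫ r) ≫ act' := by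
      simp [hT]
    rw [comp_whiskerRight, Category.assoc, h', h]
    simp [hT]
  have T_right : (A ⊗ A) ◁ act ≫ T =
      (α_ (A ⊗ A) A M).inv ≫ ((α_ A A A).hom ≫ A ◁ μ) ▷ M ≫ T := by
    have h : A ◁ (μ ▷ M) ≫ A ◁ act =
        A ◁ (α_ A A M).hom ≫ A ◁ (A ◁ act) ≫ A ◁ act := by
      simp only [← whiskerLeft_comp, hact_assoc]
    simp [hT, reassoc_of% h]
  have T_f : (A ⊗ A) ◁ f ≫ T = μ ▷ M' ≫ act' := by
    have h : A ◁ f ≫ act ≫ r = act' := by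
      rw [← Category.assoc, ← hf, Category.assoc, hr, Category.comp_id]
    rw [hact'_assoc, hT, associator_naturality_right_assoc, ← whiskerLeft_comp_assoc, h]
  refine ⟨(λ_ M).inv ≫ (u ≫ σ) ▷ M ≫ T, ?_, ?_⟩
  · trans σ ▷ M ≫ T
    · have h : (u ≫ σ) ▷ A ≫ (α_ A A A).hom ≫ A ◁ μ = (λ_ A).hom ≫ σ := by
        rw [comp_whiskerRight, Category.assoc, hsec_right, reassoc_of% hone_mul]
      rw [leftUnitor_inv_naturality_assoc, whisker_exchange_assoc, T_right,
        associator_inv_naturality_left_assoc, ← comp_whiskerRight_assoc, h]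
      simp
    · have h : A ◁ (u ≫ σ) ≫ (α_ A A A).inv ≫ μ ▷ A = (ρ_ A).hom ≫ σ := by
        rw [whiskerLeft_comp, Category.assoc, hsec_left, reassoc_of% hmul_one]
      rw [whiskerLeft_comp, whiskerLeft_comp, Category.assoc, Category.assoc, T_left,
        associator_inv_naturality_middle_assoc, ← comp_whiskerRight_assoc, h]
      simp
  · rw [leftUnitor_inv_naturality_assoc, whisker_exchange_assoc, T_f,
      ← comp_whiskerRight_assoc, Category.assoc, hsep, Category.comp_id, hact'_one,
      Iso.inv_hom_id]
end

section
/- Let k be a field of characteristic 2 and let A be a commutative k-algebra that is finite-dimensional as a k-vector space and formally unramified over k (equivalently, étale over k, i.e., separable). Suppose A is ℤ/2-graded: there is a grading 𝒜: ℤ/2 → Submodule_k A making A a graded k-algebra (A = 𝒜₀ ⊕ 𝒜₁ as k-vector spaces, 1 ∈ 𝒜₀, and 𝒜_i · 𝒜_j ⊆ 𝒜_{i+j}). Then 𝒜₁ = 0, i.e., A is concentrated in degree zero. -/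
/-- In characteristic two, the projection of a `ℤ/2`-graded commutative algebra onto its
degree one part is a derivation. -/
def GradedAlgebra.projOneDerivation {k A : Type*} [CommRing k] [CharP k 2] [CommRing A]
    [Algebra k A] (𝒜 : ZMod 2 → Submodule k A) [GradedAlgebra 𝒜] : Derivation k A A :=
  Derivation.mk' (GradedAlgebra.proj 𝒜 1) fun a b => by
    have mem (i : ZMod 2) (c : A) : GradedAlgebra.proj 𝒜 i c ∈ 𝒜 i :=
      (DirectSum.decompose 𝒜 c i).2
    have same {c : A} (hc : c ∈ 𝒜 1) : GradedAlgebra.proj 𝒜 1 c = c :=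
      DirectSum.decompose_of_mem_same 𝒜 hc
    have ne {c : A} (hc : c ∈ 𝒜 0) : GradedAlgebra.proj 𝒜 1 c = 0 :=
      DirectSum.decompose_of_mem_ne 𝒜 hc (by decide)
    have add (c : A) : c = GradedAlgebra.proj 𝒜 0 c + GradedAlgebra.proj 𝒜 1 c := by
      classical
      conv_lhs => rw [← DirectSum.sum_support_decompose 𝒜 c]
      rw [Finset.sum_subset (Finset.subset_univ _) fun i _ hi => by
        simpa using hi]
      exact Fin.sum_univ_two _
    have two : (2 : A) = 0 := by
      rw [← map_ofNat (algebraMap k A) 2, CharTwo.two_eq_zero, map_zero]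
    obtain ⟨x, y, hx, hy, rfl⟩ : ∃ x y, x ∈ 𝒜 0 ∧ y ∈ 𝒜 1 ∧ a = x + y :=
      ⟨_, _, mem 0 a, mem 1 a, add a⟩
    obtain ⟨u, v, hu, hv, rfl⟩ : ∃ u v, u ∈ 𝒜 0 ∧ v ∈ 𝒜 1 ∧ b = u + v :=
      ⟨_, _, mem 0 b, mem 1 b, add b⟩
    have hxu : x * u ∈ 𝒜 0 := SetLike.mul_mem_graded hx hu
    have hxv : x * v ∈ 𝒜 1 := SetLike.mul_mem_graded hx hv
    have hyu : y * u ∈ 𝒜 1 := SetLike.mul_mem_graded hy hu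
    have hyv : y * v ∈ 𝒜 0 := SetLike.mul_mem_graded hy hv
    simp only [add_mul, mul_add, map_add, smul_eq_mul, ne hx, ne hu, same hy, same hv,
      ne hxu, same hxv, same hyu, ne hyv]
    linear_combination (-(y * v)) * two

/-- A commutative separable (equivalently, finite-dimensional and formally unramified,
i.e. étale) algebra over a field `k` of characteristic 2 that carries a `ℤ/2`-grading
is concentrated in degree zero. -/
theorem z2_graded_separable_algebra_in_char_two_is_concentrated_in_degree_zero
    (k A : Type) [Field k] [CharP k 2] [CommRing A] [Algebra k A]
    [FiniteDimensional k A] [Algebra.FormallyUnramified k A]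
    (𝒜 : ZMod 2 → Submodule k A) [GradedAlgebra 𝒜] :
    𝒜 1 = ⊥ := by
  refine (Submodule.eq_bot_iff _).2 fun a ha => ?_
  have h : GradedAlgebra.projOneDerivation 𝒜 a = a := DirectSum.decompose_of_mem_same 𝒜 ha
  rw [← h, ← Derivation.liftKaehlerDifferential_comp_D,
    Subsingleton.elim (KaehlerDifferential.D k A a) 0, map_zero]
end

section
/- Let k be an algebraically closed field of characteristic p > 0, G a finite group, and M a finite-dimensional indecomposable kG-module with dim_k M not divisible by p. Let j: k → M^∨ ⊗ M be any split monomorphism of kG-modules and q: M^∨ ⊗ M → k any split epimorphism of kG-modules. Then there exists a nonzero scalar c ∈ k such that for every kG-linear map f: M → M, the composite q∘(id_{M^∨} ⊗ f)∘j: k → k is multiplication by c·tr(f), where tr(f) is the trace of f as a k-linear endomorphism of M. In particular, q∘j ≠ 0. -/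
open TensorProduct

section Defs

variable {k G : Type} [Field k] [Group G]

/-- A submodule is a subrepresentation if it is stable under the `G`-action. -/
def IsSubrep {V : Type} [AddCommGroup V] [Module k V] (ρ : Representation k G V)
    (p : Submodule k V) : Prop := ∀ g : G, ∀ x ∈ p, ρ g x ∈ p

/-- A representation is indecomposable if it is nonzero and not the direct sum of
two nonzero subrepresentations. -/
def IndecomposableRep {V : Type} [AddCommGroup V] [Module k V]
    (ρ : Representation k G V) : Prop :=
  Nontrivial V ∧ ¬ ∃ p q : Submodule k V,
    IsSubrep ρ p ∧ IsSubrep ρ q ∧ IsCompl p q ∧ p ≠ ⊥ ∧ q ≠ ⊥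

end Defs

section Endomorphisms

variable {k G : Type} [Field k] [Group G]
  {M : Type} [AddCommGroup M] [Module k M] {ρ : Representation k G M}

theorem Equivariant.apply_comm {f : M →ₗ[k] M} (hf : Equivariant ρ ρ f) (g : G) (x : M) :
    f (ρ g x) = ρ g (f x) :=
  LinearMap.congr_fun (hf g) x

theorem Equivariant.mul {a b : Module.End k M} (ha : Equivariant ρ ρ a)
    (hb : Equivariant ρ ρ b) : Equivariant ρ ρ (a * b) := fun g => by
  ext x
  simp [ha.apply_comm, hb.apply_comm]

theorem Equivariant.sub_algebraMap {a : Module.End k M} (ha : Equivariant ρ ρ a) (c : k) :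
    Equivariant ρ ρ (a - algebraMap k (Module.End k M) c) := fun g => by
  ext x
  simp [ha.apply_comm, Module.algebraMap_end_apply]

theorem Equivariant.pow {a : Module.End k M} (ha : Equivariant ρ ρ a) (n : ℕ) :
    Equivariant ρ ρ (a ^ n) := by
  induction n with
  | zero => exact fun g => rfl
  | succ n ih => rw [pow_succ]; exact ih.mul ha

theorem Equivariant.isSubrep_ker {a : Module.End k M} (ha : Equivariant ρ ρ a) :
    IsSubrep ρ (LinearMap.ker a) := fun g x hx => by
  rw [LinearMap.mem_ker] at hx ⊢
  rw [ha.apply_comm, hx, map_zero]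

theorem Equivariant.isSubrep_range {a : Module.End k M} (ha : Equivariant ρ ρ a) :
    IsSubrep ρ (LinearMap.range a) := by
  rintro g _ ⟨y, rfl⟩
  exact ⟨ρ g y, ha.apply_comm g y⟩

variable [FiniteDimensional k M]

/-- Fitting's lemma for an equivariant endomorphism of an indecomposable representation. -/
theorem IndecomposableRep.isNilpotent_or_isUnit (hind : IndecomposableRep ρ)
    {a : Module.End k M} (ha : Equivariant ρ ρ a) : IsNilpotent a ∨ IsUnit a := by
  obtain ⟨n, hn⟩ := Filter.eventually_atTop.1 a.eventually_isCompl_ker_pow_range_pow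
  have hcompl := hn (n + 1) n.le_succ
  have hpow := ha.pow (n + 1)
  by_cases hker : LinearMap.ker (a ^ (n + 1)) = ⊥
  · right
    exact (isUnit_pow_iff n.succ_ne_zero).1 ((LinearMap.isUnit_iff_ker_eq_bot _).2 hker)
  · left
    refine ⟨n + 1, LinearMap.range_eq_bot.1 ?_⟩
    by_contra hrange
    exact hind.2 ⟨_, _, hpow.isSubrep_ker, hpow.isSubrep_range, hcompl, hker, hrange⟩

theorem IndecomposableRep.isUnit_of_trace_mul_ne_zero (hind : IndecomposableRep ρ)
    {a b : Module.End k M} (ha : Equivariant ρ ρ a) (hb : Equivariant ρ ρ b)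
    (h : LinearMap.trace k M (a * b) ≠ 0) : IsUnit a ∧ IsUnit b := by
  have hab : IsUnit (a * b) := (hind.isNilpotent_or_isUnit (ha.mul hb)).resolve_left
    fun hnil => h (LinearMap.isNilpotent_trace_of_isNilpotent hnil).eq_zero
  rw [LinearMap.isUnit_iff_isUnit_det, map_mul, IsUnit.mul_iff] at hab
  simpa only [LinearMap.isUnit_iff_isUnit_det] using hab

/-- Over an algebraically closed field, the trace of a product of equivariant endomorphisms of an
indecomposable representation is, up to the dimension, the product of the traces. -/
theorem IndecomposableRep.exists_trace_mul_eq [IsAlgClosed k] (hind : IndecomposableRep ρ)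
    {f : Module.End k M} (hf : Equivariant ρ ρ f) :
    ∃ c : k, IsNilpotent (f - algebraMap k (Module.End k M) c) ∧
      ∀ u : Module.End k M, Equivariant ρ ρ u →
        LinearMap.trace k M (f * u) = c * LinearMap.trace k M u := by
  have := hind.1
  obtain ⟨c, hc⟩ := Module.End.exists_eigenvalue f
  have hnu : ¬ IsUnit (f - algebraMap k (Module.End k M) c) := by
    rw [LinearMap.isUnit_iff_ker_eq_bot]
    rw [Module.End.hasEigenvalue_iff, Module.End.eigenspace_def] at hc
    exact hc
  have heq := hf.sub_algebraMap c
  refine ⟨c, (hind.isNilpotent_or_isUnit heq).resolve_right hnu, fun u hu => ?_⟩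
  by_contra hne
  refine hnu (hind.isUnit_of_trace_mul_ne_zero heq hu ?_).1
  rw [sub_mul, map_sub, ← Algebra.smul_def, map_smul, smul_eq_mul]
  exact sub_ne_zero.2 hne

end Endomorphisms

section DualTensor

variable {k G : Type} [Field k] [Group G]
  {M : Type} [AddCommGroup M] [Module k M] {ρ : Representation k G M}

theorem dualTensorHom_lTensor (f : M →ₗ[k] M) (x : Module.Dual k M ⊗[k] M) :
    dualTensorHom k M M (LinearMap.lTensor (Module.Dual k M) f x)
      = f ∘ₗ dualTensorHom k M M x := by
  induction x with
  | zero => simp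
  | tmul φ m => ext; simp
  | add x y hx hy => simp [hx, hy, LinearMap.comp_add]

theorem equivariant_dualTensorHom {j : k →ₗ[k] Module.Dual k M ⊗[k] M}
    (hj : Equivariant (W := Module.Dual k M ⊗[k] M)
      (Representation.trivial k (G := G) (V := k)) (ρ.dual.tprod ρ) j) :
    Equivariant ρ ρ (dualTensorHom k M M (j 1)) := fun g => by
  have hinv : TensorProduct.map (ρ.dual g) (ρ g) (j 1) = j 1 :=
    (LinearMap.congr_fun (hj g) 1).symm
  have hcomm := LinearMap.congr_fun (Representation.dualTensorHom_comm ρ ρ g) (j 1)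
  rw [LinearMap.comp_apply, hinv] at hcomm
  ext x
  have := LinearMap.congr_fun hcomm (ρ g x)
  simpa using this

theorem exists_equivariant_eq_trace [FiniteDimensional k M]
    {q : Module.Dual k M ⊗[k] M →ₗ[k] k}
    (hq : Equivariant (V := Module.Dual k M ⊗[k] M)
      (ρ.dual.tprod ρ) (Representation.trivial k (G := G) (V := k)) q) :
    ∃ b : Module.End k M, Equivariant ρ ρ b ∧
      ∀ x, q x = LinearMap.trace k M (b * dualTensorHom k M M x) := by
  obtain ⟨b, hb⟩ : ∃ b : Module.End k M, ∀ φ m, φ (b m) = q (φ ⊗ₜ m) :=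
    ⟨(Module.evalEquiv k M).symm.toLinearMap ∘ₗ (TensorProduct.curry q).flip, by simp⟩
  refine ⟨b, fun g => ?_, fun x => ?_⟩
  · ext m
    refine (Module.forall_dual_apply_eq_zero_iff k _).1 (fun φ => ?_) |> sub_eq_zero.1
    have h := LinearMap.congr_fun (hq g) ((φ ∘ₗ ρ g) ⊗ₜ m)
    have hφ : ρ.dual g (φ ∘ₗ ρ g) = φ := by
      ext y
      simp [Representation.dual_apply, Module.Dual.transpose_apply]
    have h' : q (φ ⊗ₜ ρ g m) = q ((φ ∘ₗ ρ g) ⊗ₜ m) := by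
      rwa [LinearMap.comp_apply, Representation.tprod_apply, TensorProduct.map_tmul, hφ] at h
    rw [map_sub, LinearMap.comp_apply, LinearMap.comp_apply, hb, h', ← hb]
    simp
  · rw [Module.End.mul_eq_comp, ← dualTensorHom_lTensor, LinearMap.trace_eq_contract_apply]
    induction x with
    | zero => simp
    | tmul φ m => simp [hb]
    | add x y hx hy => simp only [map_add, hx, hy]

end DualTensor


/-- For an indecomposable module `M` of dimension prime to `p` over an algebraically
closed field, any equivariant splittings `j : k ↪ M∨ ⊗ M` and `q : M∨ ⊗ M ↠ k`
compute traces up to a fixed nonzero scalar: `q ∘ (1 ⊗ f) ∘ j` is multiplication by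
`c · tr(f)` for every `kG`-linear `f : M → M`; in particular `q ∘ j ≠ 0`. -/
theorem split_maps_compute_trace_up_to_nonzero_scalar
    (p : ℕ) (hp : p.Prime) (k : Type) [Field k] [IsAlgClosed k] [CharP k p]
    (G : Type) [Group G] [Finite G]
    (M : Type) [AddCommGroup M] [Module k M] [FiniteDimensional k M]
    (ρ : Representation k G M) (hind : IndecomposableRep ρ)
    (hdim : ¬ (p ∣ Module.finrank k M))
    (j : k →ₗ[k] Module.Dual k M ⊗[k] M)
    (hj : Equivariant (W := Module.Dual k M ⊗[k] M)
      (Representation.trivial k (G := G) (V := k)) (ρ.dual.tprod ρ) j)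
    (hjsplit : ∃ r : Module.Dual k M ⊗[k] M →ₗ[k] k,
      Equivariant (V := Module.Dual k M ⊗[k] M)
        (ρ.dual.tprod ρ) (Representation.trivial k (G := G) (V := k)) r ∧
      r ∘ₗ j = LinearMap.id)
    (q : Module.Dual k M ⊗[k] M →ₗ[k] k)
    (hq : Equivariant (V := Module.Dual k M ⊗[k] M)
      (ρ.dual.tprod ρ) (Representation.trivial k (G := G) (V := k)) q)
    (hqsplit : ∃ s : k →ₗ[k] Module.Dual k M ⊗[k] M,
      Equivariant (W := Module.Dual k M ⊗[k] M)
        (Representation.trivial k (G := G) (V := k)) (ρ.dual.tprod ρ) s ∧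
      q ∘ₗ s = LinearMap.id) :
    ∃ c : k, c ≠ 0 ∧
      (∀ f : M →ₗ[k] M, Equivariant ρ ρ f →
        q ∘ₗ LinearMap.lTensor (Module.Dual k M) f ∘ₗ j
          = (c * LinearMap.trace k M f) • (LinearMap.id : k →ₗ[k] k)) ∧
      q ∘ₗ j ≠ 0 := by
  have := hind.1
  have hd : (Module.finrank k M : k) ≠ 0 := fun h => hdim ((CharP.cast_eq_zero_iff k p _).1 h)
  obtain ⟨r, hr, hrj⟩ := hjsplit
  obtain ⟨s, hs, hqs⟩ := hqsplit
  have ha := equivariant_dualTensorHom hj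
  set a : Module.End k M := dualTensorHom k M M (j 1)
  obtain ⟨b, hb, hqb⟩ := exists_equivariant_eq_trace hq
  obtain ⟨b', hb', hrb'⟩ := exists_equivariant_eq_trace hr
  have haunit : IsUnit a := by
    refine (hind.isUnit_of_trace_mul_ne_zero hb' ha ?_).2
    rw [← hrb', ← LinearMap.comp_apply, hrj]
    exact one_ne_zero
  have hbunit : IsUnit b := by
    refine (hind.isUnit_of_trace_mul_ne_zero hb (equivariant_dualTensorHom hs) ?_).1
    rw [← hqb, ← LinearMap.comp_apply, hqs]
    exact one_ne_zero
  have hone : Equivariant ρ ρ (1 : Module.End k M) := fun _ => rfl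
  have hab := ha.mul hb
  obtain ⟨c, hnil, hc⟩ := hind.exists_trace_mul_eq hab
  have htr : LinearMap.trace k M (a * b) = c * Module.finrank k M := by
    simpa using hc 1 hone
  have hc0 : c ≠ 0 := by
    rintro rfl
    rw [map_zero, sub_zero] at hnil
    exact hnil.not_isUnit (haunit.mul hbunit)
  have hmain (f : M →ₗ[k] M) (hf : Equivariant ρ ρ f) :
      q ∘ₗ LinearMap.lTensor (Module.Dual k M) f ∘ₗ j
        = (c * LinearMap.trace k M f) • (LinearMap.id : k →ₗ[k] k) := by
    ext
    rw [LinearMap.comp_apply, LinearMap.comp_apply, hqb, dualTensorHom_lTensor,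
      LinearMap.trace_mul_comm, ← Module.End.mul_eq_comp, mul_assoc,
      LinearMap.trace_mul_comm, hc f hf]
    simp
  refine ⟨c, hc0, hmain, fun h => mul_ne_zero hc0 hd ?_⟩
  have := LinearMap.congr_fun (hmain LinearMap.id hone) 1
  rw [LinearMap.lTensor_id, LinearMap.id_comp, h] at this
  simpa using this.symm
end
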